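/- arXiv:2202.06734 — 2 statements merged into one kernel-verified Lean document; each statement's English description precedes it below -/
import Mathlib

section
/- Let G be a finite periodic gap (periodic polygon) of a cubic symmetric lamination L, say of period p (p ≥ 1 minimal with s3^p(G) = G), and let g = s3^p restricted to G be the first return map. Then exactly one of the following holds: (a) g acts on the set of edges of G transitively as a rational rotation, i.e. g permutes the edges of G in a single cycle preserving their circular order around G; or (b) the edges of G form exactly two disjoint periodic orbits under s3, some forward image s3^m(G) equals −G, and for any two adjacent edges ℓ and ℓ̂ of G there exists n ≥ 1 with s3^n(ℓ) = −ℓ̂. -/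
noncomputable section

open Set Metric

instance : Fact ((0:ℝ) < 1) := ⟨one_pos⟩

/-- The circle `S = ℝ/ℤ`. -/
abbrev S1 : Type := AddCircle (1 : ℝ)

/-- The tripling map `σ₃ : x ↦ 3x (mod 1)`. -/
def s3 : S1 → S1 := fun x => (3 : ℕ) • x

/-- The antipodal map `x ↦ x + 1/2` (denoted `−x` in the paper). -/
def antip : S1 → S1 := fun x => x + (((1:ℝ)/2 : ℝ) : S1)

/-- A chord of the circle: an unordered pair of points of `S1`. -/
abbrev Chord : Type := Sym2 S1

/-- The image chord of a chord under a circle map. -/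
def cmap (f : S1 → S1) (ℓ : Chord) : Chord := Sym2.map f ℓ

/-- The length of a chord `{a,b}`: the shorter of the two arcs joining `a` and `b`
(the natural norm on `ℝ/ℤ`). -/
def chordLen : Chord → ℝ :=
  Sym2.lift ⟨fun a b => ‖a - b‖, fun a b => norm_sub_rev a b⟩

/-- The standard embedding of the circle `ℝ/ℤ` into `ℂ` (onto the unit circle). -/
def toC (x : S1) : ℂ :=
  Complex.exp (2 * Real.pi * Complex.I * (((AddCircle.equivIco 1 0 x : Set.Ico (0:ℝ) (0+1)) : ℝ) : ℂ))

/-- The geometric chord in the closed unit disk of `ℂ` determined by an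
unordered pair of circle points. -/
def chordSet : Chord → Set ℂ :=
  Sym2.lift ⟨fun a b => segment ℝ (toC a) (toC b), fun a b => segment_symm ℝ _ _⟩

/-- Two chords cross if their endpoints strictly alternate on the circle. -/
def Crosses (ℓ₁ ℓ₂ : Chord) : Prop :=
  (∃ a b c d : ℝ, a < b ∧ b < c ∧ c < d ∧ d < a + 1 ∧
    ℓ₁ = s(((a : ℝ) : S1), ((c : ℝ) : S1)) ∧ ℓ₂ = s(((b : ℝ) : S1), ((d : ℝ) : S1))) ∨
  (∃ a b c d : ℝ, a < b ∧ b < c ∧ c < d ∧ d < a + 1 ∧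
    ℓ₂ = s(((a : ℝ) : S1), ((c : ℝ) : S1)) ∧ ℓ₁ = s(((b : ℝ) : S1), ((d : ℝ) : S1)))

/-- A critical chord: nondegenerate with degenerate `σ₃`-image. -/
def IsCritical (ℓ : Chord) : Prop := ¬ ℓ.IsDiag ∧ (cmap s3 ℓ).IsDiag

/-- The union in `ℂ` of all the chords of a family. -/
def unionSet (L : Set Chord) : Set ℂ := ⋃ ℓ ∈ L, chordSet ℓ

def openDisk : Set ℂ := Metric.ball (0:ℂ) 1
def closedDisk : Set ℂ := Metric.closedBall (0:ℂ) 1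

/-- A lamination: a family of pairwise non-crossing chords whose union is closed. -/
structure IsLamination (L : Set Chord) : Prop where
  nocross : ∀ ℓ₁ ∈ L, ∀ ℓ₂ ∈ L, ¬ Crosses ℓ₁ ℓ₂
  closed : IsClosed (unionSet L)

/-- A sibling collection: three pairwise disjoint chords with the same
nondegenerate `σ₃`-image. -/
def IsSiblingCollection (ℓ₁ ℓ₂ ℓ₃ : Chord) : Prop :=
  Disjoint (chordSet ℓ₁) (chordSet ℓ₂) ∧ Disjoint (chordSet ℓ₁) (chordSet ℓ₃) ∧
  Disjoint (chordSet ℓ₂) (chordSet ℓ₃) ∧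
  ¬ (cmap s3 ℓ₁).IsDiag ∧ cmap s3 ℓ₂ = cmap s3 ℓ₁ ∧ cmap s3 ℓ₃ = cmap s3 ℓ₁

/-- A `σ₃`-invariant lamination. -/
structure IsInvLam (L : Set Chord) extends IsLamination L : Prop where
  forward : ∀ ℓ ∈ L, cmap s3 ℓ ∈ L ∨ (cmap s3 ℓ).IsDiag
  backward : ∀ ℓ ∈ L, ∃ ℓ' ∈ L, cmap s3 ℓ' = ℓ
  siblings : ∀ ℓ ∈ L, ¬ (cmap s3 ℓ).IsDiag →
    ∃ ℓ₂ ∈ L, ∃ ℓ₃ ∈ L, IsSiblingCollection ℓ ℓ₂ ℓ₃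

/-- A cubic symmetric lamination. -/
structure IsCubicSymLam (L : Set Chord) extends IsInvLam L : Prop where
  symm : ∀ ℓ ∈ L, cmap antip ℓ ∈ L

/-- A major: a leaf whose length is closest to `1/3` among all leaves. -/
def IsMajor (L : Set Chord) (M : Chord) : Prop :=
  M ∈ L ∧ ∀ ℓ ∈ L, |1/3 - chordLen M| ≤ |1/3 - chordLen ℓ|

/-- A minor: the `σ₃`-image of a major. -/
def IsMinor (L : Set Chord) (m : Chord) : Prop := ∃ M, IsMajor L M ∧ m = cmap s3 M

/-- A comajor: a short (or degenerate) sibling of a major, disjoint from all majors. -/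
def IsComajor (L : Set Chord) (c : Chord) : Prop :=
  (chordLen c < 1/6 ∨ c.IsDiag) ∧ (¬ c.IsDiag → c ∈ L) ∧
  (∃ M, IsMajor L M ∧ cmap s3 c = cmap s3 M) ∧
  (∀ M, IsMajor L M → Disjoint (chordSet c) (chordSet M))

/-- The cubic symmetric comajor lamination: all comajors of all cubic symmetric
laminations. -/
def CsCL : Set Chord := {c | ∃ L, IsCubicSymLam L ∧ IsComajor L c}

/-- A chord is periodic if some positive iterate of `σ₃` fixes it. -/
def ChordPeriodic (c : Chord) : Prop := ∃ p, 1 ≤ p ∧ cmap (s3^[p]) c = c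

/-- A comajor is co-periodic if its image is periodic but it is not. -/
def CoPeriodic (c : Chord) : Prop := ChordPeriodic (cmap s3 c) ∧ ¬ ChordPeriodic c

/-- The point of the unit circle in `ℂ` with argument `2πt`. -/
def circPt (t : ℝ) : ℂ := toC ((t : ℝ) : S1)

/-- The (closed) arc of the circle in `ℂ` from angle `u` to angle `v` (traversed
positively), as a subset of `ℂ`. -/
def arcSet (u v : ℝ) : Set ℂ := circPt '' Set.Icc u v

/-- The unordered arc between angles `u` and `v`. -/
def arcSetU (u v : ℝ) : Set ℂ := circPt '' Set.uIcc u v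

/-- The closed region `R(n)` bounded by the chord from angle `a` to angle `a+t`
(with `t` the length of the chord) and the corresponding (shorter) arc `H(n)`:
the convex hull of that arc. -/
def regionUnder (a t : ℝ) : Set ℂ := convexHull ℝ (arcSet a (a + t))

/-- `Under m n` (`m ≺ n`): `m` is contained in the region `R(n)`. -/
def Under (m n : Chord) : Prop :=
  ∃ a t : ℝ, 0 ≤ t ∧ t < 1/2 ∧ t = chordLen n ∧
    n = s(((a : ℝ) : S1), ((a + t : ℝ) : S1)) ∧ chordSet m ⊆ regionUnder a t

/-- The (closed) strip `C(ℓ)` between the medium/long chord `ℓ` from angle `a` to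
angle `a+t` (with `1/6 < t ≤ 1/2` its length) and its medium/long sibling
`ℓ' = {a+1/3, a+t-1/3}`. -/
def stripSet (a t : ℝ) : Set ℂ :=
  convexHull ℝ (arcSetU (a + t) (a + 1/3) ∪ arcSetU (a + t - 1/3) a)

/-- The short strips `SH(ℓ) = C(ℓ) ∪ −C(ℓ)`. -/
def SHSet (a t : ℝ) : Set ℂ := stripSet a t ∪ stripSet (a + 1/2) t

/-- For a short chord `c` from angle `a` to angle `a+t` (`0 ≤ t < 1/6`), the strip
`C(M_c)` between the two medium/long chords `M_c = {a+2/3, a+t+1/3}` and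
`M'_c = {a+1/3, a+t+2/3}` having the same `σ₃`-image as `c`. -/
def QStrip (a t : ℝ) : Set ℂ :=
  convexHull ℝ (arcSet (a + 1/3) (a + t + 1/3) ∪ arcSet (a + 2/3) (a + t + 2/3))

/-- A legal (symmetric) pair `{c, −c}`. -/
def IsLegalPair (c : Chord) : Prop :=
  c.IsDiag ∨
  ∃ a t : ℝ, 0 < t ∧ t < 1/6 ∧ t = chordLen c ∧
    c = s(((a : ℝ) : S1), ((a + t : ℝ) : S1)) ∧
    (∀ i j : ℕ,
      ¬ Crosses (cmap (s3^[i]) c) (cmap (s3^[j]) c) ∧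
      ¬ Crosses (cmap (s3^[i]) c) (cmap (s3^[j]) (cmap antip c)) ∧
      ¬ Crosses (cmap (s3^[i]) (cmap antip c)) (cmap (s3^[j]) (cmap antip c))) ∧
    (∀ i : ℕ, 1 ≤ i →
      chordSet (cmap (s3^[i]) c) ∩ interior (QStrip a t ∪ QStrip (a + 1/2) t) = ∅)

/-- A gap of a lamination: the closure of a connected component of the complement,
in the open unit disk, of the union of the leaves. -/
def IsGapOf (L : Set Chord) (G : Set ℂ) : Prop :=
  ∃ z ∈ openDisk \ unionSet L, G = closure (connectedComponentIn (openDisk \ unionSet L) z)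

/-- The vertices of a gap: its points on the circle. -/
def gapVerts (G : Set ℂ) : Set S1 := {x : S1 | toC x ∈ G}

/-- The image of a gap: the convex hull of the `σ₃`-image of its vertex set. -/
def gapImage (G : Set ℂ) : Set ℂ := convexHull ℝ (toC '' (s3 '' gapVerts G))

/-- Iterated gap images. -/
def gapIter (n : ℕ) (G : Set ℂ) : Set ℂ := gapImage^[n] G

/-- An edge of a gap: a nondegenerate chord contained in its boundary. -/
def IsEdgeOf (G : Set ℂ) (ℓ : Chord) : Prop := ¬ ℓ.IsDiag ∧ chordSet ℓ ⊆ frontier G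

/-- The (first return) map `σ₃^p` on the gap `G` has degree greater than one:
some edge of the image gap has (at least) two disjoint preimage edges in `G`. -/
def GapDegreeGE2 (G : Set ℂ) (p : ℕ) : Prop :=
  ∃ m e₁ e₂ : Chord, IsEdgeOf (gapIter p G) m ∧ e₁ ≠ e₂ ∧
    IsEdgeOf G e₁ ∧ IsEdgeOf G e₂ ∧ Disjoint (chordSet e₁) (chordSet e₂) ∧
    cmap (s3^[p]) e₁ = m ∧ cmap (s3^[p]) e₂ = m

/-- `L` has a periodic infinite gap of degree greater than one (hyperbolicity). -/
def HasHyperbolicGap (L : Set Chord) : Prop :=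
  ∃ G p, IsGapOf L G ∧ (gapVerts G).Infinite ∧ 1 ≤ p ∧ gapIter p G = G ∧ GapDegreeGE2 G p

/-- Two circle points are joined by a finite concatenation of leaves of `L`. -/
def ChainJoined (L : Set Chord) : S1 → S1 → Prop :=
  Relation.ReflTransGen (fun x y => ∃ ℓ ∈ L, x ∈ ℓ ∧ y ∈ ℓ)

/-- A q-lamination: points joined by finite concatenations of leaves are vertices of
a single leaf or finite gap. -/
def IsQLam (L : Set Chord) : Prop :=
  ∀ x y : S1, ChainJoined L x y →
    x = y ∨ (∃ ℓ ∈ L, x ∈ ℓ ∧ y ∈ ℓ) ∨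
    (∃ G, IsGapOf L G ∧ (gapVerts G).Finite ∧ toC x ∈ G ∧ toC y ∈ G)

/-- A periodic point of `σ₃`. -/
def PerPt (x : S1) : Prop := ∃ p, 1 ≤ p ∧ s3^[p] x = x

/-- An eventually periodic point of `σ₃`. -/
def EvPerPt (x : S1) : Prop := ∃ k, PerPt (s3^[k] x)

/-- `x` is strictly preperiodic of preperiod `k ≥ 1` and period `p`. -/
def StrictPreper (x : S1) (k p : ℕ) : Prop :=
  1 ≤ k ∧ 1 ≤ p ∧ s3^[p] (s3^[k] x) = s3^[k] x ∧
  (∀ j < k, ¬ PerPt (s3^[j] x)) ∧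
  (∀ q, 1 ≤ q → s3^[q] (s3^[k] x) = s3^[k] x → p ≤ q)

/-- A periodic point of type B: of period `2n` with `σ₃ⁿ(x) = −x`. -/
def TypeB (x : S1) : Prop :=
  ∃ n, 1 ≤ n ∧ Function.minimalPeriod s3 x = 2 * n ∧ s3^[n] x = antip x

/-- `c` is a two-sided limit of chords of the family `A`: within every complementary
component of the disk minus `c` there are chords of `A` converging to `c`. -/
def TwoSidedLimitOf (A : Set Chord) (c : Chord) : Prop :=
  ∀ z ∈ closedDisk \ chordSet c, ∀ ε : ℝ, 0 < ε →
    ∃ d ∈ A, d ≠ c ∧ chordSet d ⊆ connectedComponentIn (closedDisk \ chordSet c) z ∧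
      Metric.hausdorffDist (chordSet d) (chordSet c) < ε

/-- The chord `n` weakly separates the chords `ℓ₁` and `ℓ₂`. -/
def WeaklySep (n ℓ₁ ℓ₂ : Chord) : Prop :=
  ∃ z₁ ∈ chordSet ℓ₁ \ chordSet n, ∃ z₂ ∈ chordSet ℓ₂ \ chordSet n,
    chordSet ℓ₁ \ chordSet n ⊆ connectedComponentIn (closedDisk \ chordSet n) z₁ ∧
    chordSet ℓ₂ \ chordSet n ⊆ connectedComponentIn (closedDisk \ chordSet n) z₂ ∧
    connectedComponentIn (closedDisk \ chordSet n) z₁ ≠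
      connectedComponentIn (closedDisk \ chordSet n) z₂

/-- The (non-diameter, non-fixed) chord `ℓ` moves in under the circle map `h`. -/
def MovesIn (h : S1 → S1) (ℓ : Chord) : Prop := cmap h ℓ ≠ ℓ ∧ Under (cmap h ℓ) ℓ

/-- The chord `ℓ` moves out under the circle map `h`. -/
def MovesOut (h : S1 → S1) (ℓ : Chord) : Prop := cmap h ℓ ≠ ℓ ∧ ¬ Under (cmap h ℓ) ℓ

/-- Strict circular betweenness on the circle: `y` lies strictly between `x` and `z`
in the positive circular order. -/
def Sbtw3 (x y z : S1) : Prop :=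
  ∃ a b c : ℝ, x = ((a : ℝ) : S1) ∧ y = ((b : ℝ) : S1) ∧ z = ((c : ℝ) : S1) ∧
    a < b ∧ b < c ∧ c < a + 1

/-- The length, in `[0,1)`, of the positively oriented arc from `x` to `y`. -/
def arcLen (x y : S1) : ℝ := (AddCircle.equivIco 1 0 (y - x) : Set.Ico (0:ℝ) (0+1))

lemma arcLen_nonneg (x y : S1) : 0 ≤ arcLen x y := (AddCircle.equivIco 1 0 (y - x)).2.1

lemma arcLen_lt_one (x y : S1) : arcLen x y < 1 :=
  (AddCircle.equivIco (1:ℝ) 0 (y - x)).2.2.trans_eq (zero_add 1)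

lemma add_arcLen (x y : S1) : x + ((arcLen x y : ℝ) : S1) = y := by
  have h : ((arcLen x y : ℝ) : S1) = y - x := AddCircle.coe_equivIco
  rw [h]; abel

lemma arcLen_add_of_mem (x : S1) {r : ℝ} (h0 : 0 ≤ r) (h1 : r < 1) :
    arcLen x (x + (r : S1)) = r := by
  unfold arcLen
  rw [add_sub_cancel_left, AddCircle.equivIco_coe_eq (by constructor <;> linarith)]

lemma coe_add_int (a : ℝ) (n : ℤ) : ((a + n : ℝ) : S1) = (a : S1) := by
  have h : ((n : ℝ) : S1) = 0 := AddCircle.coe_eq_zero_iff (1:ℝ) |>.2 ⟨n, by simp⟩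
  rw [AddCircle.coe_add, h, add_zero]

lemma coe_fract (a : ℝ) : ((Int.fract a : ℝ) : S1) = (a : S1) := by
  conv_rhs => rw [← Int.fract_add_floor a]
  rw [coe_add_int]

lemma arcLen_add_add (w : S1) (a b : ℝ) :
    arcLen (w + (a : S1)) (w + (b : S1)) = Int.fract (b - a) := by
  have h : w + (b : S1) = w + (a : S1) + ((Int.fract (b - a) : ℝ) : S1) := by
    rw [coe_fract, add_assoc, ← AddCircle.coe_add]; congr 2; ring
  rw [h, arcLen_add_of_mem _ (Int.fract_nonneg _) (Int.fract_lt_one _)]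

lemma arcLen_coe (a b : ℝ) : arcLen (a : S1) (b : S1) = Int.fract (b - a) := by
  simpa using arcLen_add_add 0 a b

lemma arcLen_self (x : S1) : arcLen x x = 0 := by
  simpa using arcLen_add_of_mem x le_rfl zero_lt_one

lemma arcLen_eq_zero {x y : S1} : arcLen x y = 0 ↔ x = y := by
  constructor
  · intro h
    have := add_arcLen x y
    rwa [h, AddCircle.coe_zero, add_zero] at this
  · rintro rfl; exact arcLen_self x

lemma arcLen_pos {x y : S1} : 0 < arcLen x y ↔ x ≠ y := by
  rw [← not_iff_not, not_lt, ne_eq, not_not, ← arcLen_eq_zero]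
  exact ⟨fun h => le_antisymm h (arcLen_nonneg _ _), fun h => h.le⟩

lemma arcLen_left_inj {x y z : S1} (h : arcLen x y = arcLen x z) : y = z := by
  rw [← add_arcLen x y, h, add_arcLen]

/-- The arc length from `x` to `y` in terms of positions relative to a base point `u`. -/
lemma arcLen_of_base (u x y : S1) :
    (arcLen u x ≤ arcLen u y ∧ arcLen x y = arcLen u y - arcLen u x) ∨
    (arcLen u y < arcLen u x ∧ arcLen x y = arcLen u y - arcLen u x + 1) := by
  have h := arcLen_add_add u (arcLen u x) (arcLen u y)
  rw [add_arcLen, add_arcLen] at h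
  have h1 := arcLen_nonneg u x
  have h2 := arcLen_nonneg u y
  have h3 := arcLen_lt_one u x
  have h4 := arcLen_lt_one u y
  rcases le_or_gt (arcLen u x) (arcLen u y) with hc | hc
  · left
    refine ⟨hc, ?_⟩
    rw [h, Int.fract_eq_self.2]; constructor <;> linarith
  · right
    refine ⟨hc, ?_⟩
    rw [h, Int.fract_eq_iff]
    refine ⟨by linarith, by linarith, -1, by push_cast; ring⟩

lemma arcLen_s3 (x y : S1) : arcLen (s3 x) (s3 y) = Int.fract (3 * arcLen x y) := by
  have h : s3 y = s3 x + ((3 * arcLen x y : ℝ) : S1) := by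
    conv_lhs => rw [← add_arcLen x y]
    simp only [s3, smul_add]
    rw [← AddCircle.coe_nsmul]; simp
  rw [h]
  simpa using arcLen_add_add (s3 x) 0 (3 * arcLen x y)

lemma arcLen_antip (x y : S1) : arcLen (antip x) (antip y) = arcLen x y := by
  unfold antip arcLen; rw [add_sub_add_right_eq_sub]

lemma s3_add (x : S1) (r : ℝ) : s3 (x + (r : S1)) = s3 x + ((3 * r : ℝ) : S1) := by
  simp only [s3, smul_add]
  rw [← AddCircle.coe_nsmul]; simp

lemma antip_antip (x : S1) : antip (antip x) = x := by
  unfold antip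
  rw [add_assoc, ← AddCircle.coe_add]
  norm_num [AddCircle.coe_period]

lemma antip_injective : Function.Injective antip := fun x y h => by
  rw [← antip_antip x, h, antip_antip]

lemma s3_antip (x : S1) : s3 (antip x) = antip (s3 x) := by
  unfold antip
  rw [s3_add]
  congr 1
  have := coe_add_int (1/2) 1
  rw [← this]; congr 1; norm_num

lemma iterate_s3_antip (n : ℕ) (x : S1) : s3^[n] (antip x) = antip (s3^[n] x) :=
  (Function.Commute.iterate_left s3_antip n) x

lemma crosses_add (w : S1) {a b c d : ℝ} (h1 : a < b) (h2 : b < c) (h3 : c < d)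
    (h4 : d < a + 1) :
    Crosses s(w + (a : S1), w + (c : S1)) s(w + (b : S1), w + (d : S1)) := by
  obtain ⟨t, rfl⟩ := QuotientAddGroup.mk_surjective w
  left
  refine ⟨t + a, t + b, t + c, t + d, by linarith, by linarith, by linarith, by linarith, ?_, ?_⟩
  · rw [AddCircle.coe_add, AddCircle.coe_add]
  · rw [AddCircle.coe_add, AddCircle.coe_add]

lemma crosses_of_arcLen {x y z w : S1} (h1 : 0 < arcLen x z) (h2 : arcLen x z < arcLen x y)
    (h3 : arcLen x y < arcLen x w) : Crosses s(x, y) s(z, w) := by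
  have h := crosses_add x h1 h2 h3 (by linarith [arcLen_lt_one x w])
  rwa [add_arcLen, add_arcLen, add_arcLen, AddCircle.coe_zero, add_zero] at h

lemma sbtw3_iff {x y z : S1} : Sbtw3 x y z ↔ 0 < arcLen x y ∧ arcLen x y < arcLen x z := by
  constructor
  · rintro ⟨a, b, c, rfl, rfl, rfl, h1, h2, h3⟩
    rw [arcLen_coe, arcLen_coe, Int.fract_eq_self.2 ⟨by linarith, by linarith⟩,
      Int.fract_eq_self.2 ⟨by linarith, by linarith⟩]
    constructor <;> linarith
  · rintro ⟨h1, h2⟩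
    obtain ⟨t, rfl⟩ := QuotientAddGroup.mk_surjective x
    refine ⟨t, t + arcLen t y, t + arcLen t z, rfl, ?_, ?_, by linarith, by linarith,
      by linarith [arcLen_lt_one t z]⟩
    · rw [AddCircle.coe_add]; exact (add_arcLen _ _).symm
    · rw [AddCircle.coe_add]; exact (add_arcLen _ _).symm

/-- `(u, v)` is a positively oriented pair of consecutive points of `W`. -/
structure IsHole (W : Set S1) (u v : S1) : Prop where
  left_mem : u ∈ W
  right_mem : v ∈ W
  ne : u ≠ v
  le : ∀ x ∈ W, x ≠ u → arcLen u v ≤ arcLen u x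

lemma exists_hole_left {W : Set S1} (hW : W.Finite) {u z : S1} (hu : u ∈ W) (hz : z ∈ W)
    (hzu : z ≠ u) : ∃ v, IsHole W u v := by
  obtain ⟨v, ⟨hv, hvu⟩, hmin⟩ := Set.exists_min_image (W \ {u}) (arcLen u)
    (hW.subset sdiff_subset) ⟨z, hz, hzu⟩
  exact ⟨v, hu, hv, fun h => hvu h.symm, fun x hx hxu => hmin x ⟨hx, hxu⟩⟩

lemma IsHole.right_unique {W : Set S1} {u v v' : S1} (h : IsHole W u v) (h' : IsHole W u v') :
    v = v' :=
  arcLen_left_inj (le_antisymm (h.le v' h'.right_mem h'.ne.symm) (h'.le v h.right_mem h.ne.symm))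

lemma IsHole.left_unique {W : Set S1} {u u' v : S1} (h : IsHole W u v) (h' : IsHole W u' v) :
    u = u' := by
  by_contra hne
  have h1 := h.le u' h'.left_mem (Ne.symm hne)
  have h2 := h'.le u h.left_mem hne
  have h3 := arcLen_pos.2 hne
  have h4 := arcLen_pos.2 (Ne.symm hne)
  have h5 := arcLen_pos.2 h.ne
  have h6 := arcLen_pos.2 h'.ne
  have h7 := arcLen_self u
  rcases arcLen_of_base u u' v with ⟨_, _⟩ | ⟨_, _⟩ <;>
  rcases arcLen_of_base u u' u with ⟨_, _⟩ | ⟨_, _⟩ <;> linarith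

/-- A set of points closed under passing to the next point is everything. -/
lemma forall_mem_of_hole_step {W : Set S1} (hW : W.Finite) (P : S1 → Prop) {u : S1}
    (hu : u ∈ W) (hPu : P u) (step : ∀ x y, IsHole W x y → P x → P y) : ∀ z ∈ W, P z := by
  intro z hz
  by_contra hPz
  obtain ⟨x, ⟨hx, hPx⟩, hmin⟩ := Set.exists_min_image {x ∈ W | P x} (fun x => arcLen x z)
    (hW.subset (sep_subset _ _)) ⟨u, hu, hPu⟩
  have hzx : z ≠ x := by rintro rfl; exact hPz hPx
  obtain ⟨y, hy⟩ := exists_hole_left hW hx hz hzx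
  have h1 := hmin y ⟨hy.right_mem, step x y hy hPx⟩
  have h2 := hy.le z hz hzx
  have h3 := arcLen_pos.2 hy.ne
  rcases arcLen_of_base x y z with ⟨_, _⟩ | ⟨_, _⟩ <;> linarith

lemma eq_or_eq_of_holes {W : Set S1} {u v : S1} (h : IsHole W u v) (h' : IsHole W v u)
    {x : S1} (hx : x ∈ W) : x = u ∨ x = v := by
  by_contra! hne
  have h1 := h.le x hx hne.1
  have h2 := h'.le x hx hne.2
  have h3 := arcLen_self u
  have h4 := arcLen_pos.2 h.ne
  have h5 := arcLen_lt_one u x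
  rcases arcLen_of_base u v u with ⟨_, _⟩ | ⟨_, _⟩ <;>
  rcases arcLen_of_base u v x with ⟨_, _⟩ | ⟨_, _⟩ <;> linarith

/-- A chord family is unlinked if no two of its members cross. -/
def Unlinked (L : Set Chord) : Prop := ∀ ℓ₁ ∈ L, ∀ ℓ₂ ∈ L, ¬ Crosses ℓ₁ ℓ₂

lemma Unlinked.false_of_arcLen {L : Set Chord} (hL : Unlinked L) {x y z w : S1}
    (hxy : s(x, y) ∈ L) (hzw : s(z, w) ∈ L) (h1 : 0 < arcLen x z) (h2 : arcLen x z < arcLen x y)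
    (h3 : arcLen x y < arcLen x w) : False :=
  hL _ hxy _ hzw (crosses_of_arcLen h1 h2 h3)

/-- A finite point set with at least three points whose consecutive pairs are leaves of `L`,
without diagonals in `L`, and fixed pointwise by the `N`-th iterate of `s3`. -/
structure IsPolygon (L : Set Chord) (N : ℕ) (W : Set S1) : Prop where
  finite : W.Finite
  third : ∀ x y, ∃ z ∈ W, z ≠ x ∧ z ≠ y
  hole_mem : ∀ u v, IsHole W u v → s(u, v) ∈ L
  diag : ∀ u ∈ W, ∀ v ∈ W, u ≠ v → s(u, v) ∈ L → IsHole W u v ∨ IsHole W v u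
  periodic : ∀ x ∈ W, s3^[N] x = x

lemma exists_surrounding_hole {W : Set S1} (hW : W.Finite) {c₀ c₁ b : S1} (h₀ : c₀ ∈ W)
    (h₁ : c₁ ∈ W) (hne : c₀ ≠ c₁) (hb : b ∉ W) :
    ∃ c e, IsHole W c e ∧ 0 < arcLen c b ∧ arcLen c b < arcLen c e := by
  obtain ⟨c, hc, hmin⟩ := Set.exists_min_image W (fun x => arcLen x b) hW ⟨c₀, h₀⟩
  have hcb : c ≠ b := by rintro rfl; exact hb hc
  obtain ⟨e, he⟩ : ∃ e, IsHole W c e := by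
    by_cases h : c₀ = c
    · exact exists_hole_left hW hc h₁ (by rw [← h]; exact hne.symm)
    · exact exists_hole_left hW hc h₀ h
  refine ⟨c, e, he, arcLen_pos.2 hcb, ?_⟩
  by_contra! hle
  have h1 := hmin e he.right_mem
  have h2 := arcLen_pos.2 he.ne
  rcases arcLen_of_base c e b with ⟨_, _⟩ | ⟨_, _⟩ <;> linarith

lemma right_mem_of_separates {L : Set Chord} (hL : Unlinked L) {W : Set S1} (hW : W.Finite)
    (hWL : ∀ u v, IsHole W u v → s(u, v) ∈ L) {a b w₁ w₂ : S1} (hab : s(a, b) ∈ L)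
    (hw₁ : w₁ ∈ W) (hw₂ : w₂ ∈ W) (h1 : 0 < arcLen a w₁) (h2 : arcLen a w₁ < arcLen a b)
    (h3 : arcLen a b < arcLen a w₂) : b ∈ W := by
  by_contra hb
  obtain ⟨c, e, hce, h4, h5⟩ := exists_surrounding_hole hW hw₁ hw₂
    (by rintro rfl; linarith) hb
  have h6 : arcLen c a ≤ arcLen c e := by
    by_contra! h6
    exact hL.false_of_arcLen (hWL _ _ hce) (Sym2.eq_swap ▸ hab) h4 h5 h6
  have hpos : ∀ w ∈ W, arcLen c w = 0 ∨ arcLen c e ≤ arcLen c w := by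
    intro w hw
    by_cases h : w = c
    · left; rw [h, arcLen_self]
    · right; exact hce.le w hw h
  have h8 := arcLen_nonneg c a
  have h9 := arcLen_lt_one c w₂
  have h10 := arcLen_lt_one c a
  rcases hpos _ hw₁ with h11 | h11 <;> rcases hpos _ hw₂ with h12 | h12 <;>
  rcases arcLen_of_base c a b with ⟨_, _⟩ | ⟨_, _⟩ <;>
  rcases arcLen_of_base c a w₁ with ⟨_, _⟩ | ⟨_, _⟩ <;>
  rcases arcLen_of_base c a w₂ with ⟨_, _⟩ | ⟨_, _⟩ <;> linarith

lemma mem_of_separates {L : Set Chord} (hL : Unlinked L) {W : Set S1} (hW : W.Finite)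
    (hWL : ∀ u v, IsHole W u v → s(u, v) ∈ L) {a b w₁ w₂ : S1} (hab : s(a, b) ∈ L)
    (hw₁ : w₁ ∈ W) (hw₂ : w₂ ∈ W) (h1 : 0 < arcLen a w₁) (h2 : arcLen a w₁ < arcLen a b)
    (h3 : arcLen a b < arcLen a w₂) : a ∈ W ∧ b ∈ W := by
  refine ⟨?_, right_mem_of_separates hL hW hWL hab hw₁ hw₂ h1 h2 h3⟩
  have h4 := arcLen_self a
  have h5 := arcLen_lt_one a w₂
  apply right_mem_of_separates hL hW hWL (a := b) (b := a) (Sym2.eq_swap ▸ hab) hw₂ hw₁ <;>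
  rcases arcLen_of_base a b a with ⟨_, _⟩ | ⟨_, _⟩ <;>
  rcases arcLen_of_base a b w₁ with ⟨_, _⟩ | ⟨_, _⟩ <;>
  rcases arcLen_of_base a b w₂ with ⟨_, _⟩ | ⟨_, _⟩ <;> linarith

/-- A leaf does not have points of a polygon strictly on both sides. -/
lemma IsPolygon.not_separated {L : Set Chord} (hL : Unlinked L) {N : ℕ} {W : Set S1}
    (hW : IsPolygon L N W) {a b w₁ w₂ : S1} (hab : s(a, b) ∈ L)
    (hw₁ : w₁ ∈ W) (hw₂ : w₂ ∈ W) (h1 : 0 < arcLen a w₁) (h2 : arcLen a w₁ < arcLen a b)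
    (h3 : arcLen a b < arcLen a w₂) : False := by
  obtain ⟨ha, hb⟩ := mem_of_separates hL hW.finite hW.hole_mem hab hw₁ hw₂ h1 h2 h3
  have hne : a ≠ b := arcLen_pos.1 (by linarith)
  rcases hW.diag a ha b hb hne hab with h | h
  · have := h.le w₁ hw₁ (arcLen_pos.1 h1).symm
    linarith
  · have h4 := h.le w₂ hw₂ (by rintro rfl; linarith)
    have h5 := arcLen_self a
    have h6 := arcLen_lt_one a w₂
    rcases arcLen_of_base a b a with ⟨_, _⟩ | ⟨_, _⟩ <;>
    rcases arcLen_of_base a b w₂ with ⟨_, _⟩ | ⟨_, _⟩ <;> linarith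

/-- If a hole of `W` lies under a leaf `(c, e)`, then either they coincide or all of `W` lies
under that leaf. -/
lemma IsPolygon.eq_or_subset_of_hole_le {L : Set Chord} (hL : Unlinked L) {N : ℕ} {W : Set S1}
    (hW : IsPolygon L N W) {a b c e : S1} (hab : IsHole W a b) (hce : s(c, e) ∈ L)
    (hle : arcLen c a + arcLen a b ≤ arcLen c e) :
    (a = c ∧ b = e) ∨ ∀ w ∈ W, arcLen c w ≤ arcLen c e := by
  rw [or_iff_not_imp_right]
  intro h
  push Not at h
  obtain ⟨w, hw, hwe⟩ := h
  have hnot : ∀ z ∈ W, 0 < arcLen c z → arcLen c e ≤ arcLen c z := fun z hz h1 => by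
    by_contra! h2
    exact hW.not_separated hL hce hz hw h1 h2 hwe
  have h1 := arcLen_pos.2 hab.ne
  have hac : a = c := by
    by_contra hne
    have := hnot a hab.left_mem (arcLen_pos.2 (Ne.symm hne))
    linarith
  subst hac
  refine ⟨rfl, arcLen_left_inj (le_antisymm ?_ (hnot b hab.right_mem h1))⟩
  rw [arcLen_self] at hle; linarith

lemma IsPolygon.subset_of_hole {L : Set Chord} (hL : Unlinked L) {N : ℕ} {W W' : Set S1}
    (hW : IsPolygon L N W) (hW' : IsPolygon L N W') {u v : S1} (h : IsHole W u v)
    (h' : IsHole W' u v) : W ⊆ W' := by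
  intro w hw
  by_contra hw'
  obtain ⟨c, e, hce, h1, h2⟩ := exists_surrounding_hole hW'.finite h'.left_mem h'.right_mem
    h.ne hw'
  have hL' := hW'.hole_mem _ _ hce
  have key : ∀ z ∈ W', z ∈ W → z = c ∨ z = e := by
    intro z hz' hz
    by_contra! hne
    have h3 := hce.le z hz' hne.1
    have h4 : arcLen c e ≠ arcLen c z := fun h => hne.2 (arcLen_left_inj h).symm
    exact hW.not_separated hL hL' hw hz h1 h2 (lt_of_le_of_ne h3 h4)
  rcases key u h'.left_mem h.left_mem with rfl | rfl
  · rw [h'.right_unique hce] at h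
    have := h.le w hw (arcLen_pos.1 h1).symm
    linarith
  · rcases key v h'.right_mem h.right_mem with rfl | rfl
    · obtain ⟨z, hz, hz1, hz2⟩ := hW'.third u v
      exact (eq_or_eq_of_holes h' hce hz).elim hz1 hz2
    · exact h.ne rfl

lemma IsPolygon.eq_of_hole {L : Set Chord} (hL : Unlinked L) {N : ℕ} {W W' : Set S1}
    (hW : IsPolygon L N W) (hW' : IsPolygon L N W') {u v : S1} (h : IsHole W u v)
    (h' : IsHole W' u v) : W = W' :=
  (hW.subset_of_hole hL hW' h h').antisymm (hW'.subset_of_hole hL hW h' h)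

lemma eq_add_third_of_s3_eq {x x' : S1} (h : s3 x' = s3 x) (hne : x' ≠ x) :
    x' = x + ((1/3 : ℝ) : S1) ∨ x' = x + ((2/3 : ℝ) : S1) := by
  have h1 := arcLen_s3 x x'
  rw [h, arcLen_self] at h1
  have h2 := arcLen_pos.2 hne.symm
  have h3 := arcLen_lt_one x x'
  obtain ⟨n, hn⟩ := Int.fract_eq_zero_iff.1 h1.symm
  have h4 : (0:ℝ) < n := by rw [hn]; linarith
  have h5 : (n:ℝ) < 3 := by rw [hn]; linarith
  have h6 : 0 < n := by exact_mod_cast h4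
  have h7 : n < 3 := by exact_mod_cast h5
  have h8 := add_arcLen x x'
  interval_cases n
  · left; rw [← h8]; congr 2; push_cast at hn; linarith
  · right; rw [← h8]; congr 2; push_cast at hn; linarith

lemma s3_add_third (x : S1) : s3 (x + ((1/3 : ℝ) : S1)) = s3 x := by
  rw [s3_add]; norm_num [AddCircle.coe_period]

lemma s3_add_two_thirds (x : S1) : s3 (x + ((2/3 : ℝ) : S1)) = s3 x := by
  rw [s3_add]
  have := coe_add_int 0 2
  norm_num at this ⊢
  exact this

lemma add_coe_ne (x : S1) {r : ℝ} (h0 : 0 < r) (h1 : r < 1) : x + (r : S1) ≠ x := by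
  intro h
  have h2 := arcLen_add_of_mem x h0.le h1
  rw [h, arcLen_self] at h2
  exact h0.ne h2

lemma toC_mem_chordSet {x : S1} {ℓ : Chord} (h : x ∈ ℓ) : toC x ∈ chordSet ℓ := by
  induction ℓ using Sym2.ind with
  | _ a b =>
    rcases Sym2.mem_iff.1 h with rfl | rfl
    · exact left_mem_segment ℝ _ _
    · exact right_mem_segment ℝ _ _

lemma ne_of_disjoint {ℓ ℓ' : Chord} (h : Disjoint (chordSet ℓ) (chordSet ℓ')) {x y : S1}
    (hx : x ∈ ℓ) (hy : y ∈ ℓ') : x ≠ y := by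
  rintro rfl
  exact Set.disjoint_left.1 h (toC_mem_chordSet hx) (toC_mem_chordSet hy)

lemma exists_rep_of_cmap_eq {ℓ : Chord} {x y : S1} (h : cmap s3 ℓ = cmap s3 s(x, y)) :
    ∃ x' y', ℓ = s(x', y') ∧ s3 x' = s3 x ∧ s3 y' = s3 y := by
  induction ℓ using Sym2.ind with
  | _ a b =>
    simp only [cmap, Sym2.map_mk, Sym2.eq_iff] at h
    rcases h with ⟨h1, h2⟩ | ⟨h1, h2⟩
    · exact ⟨a, b, rfl, h1, h2⟩
    · exact ⟨b, a, Sym2.eq_swap, h2, h1⟩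

lemma IsCubicSymLam.unlinked {L : Set Chord} (hL : IsCubicSymLam L) : Unlinked L :=
  hL.nocross

lemma IsCubicSymLam.sibling_cases {L : Set Chord} (hL : IsCubicSymLam L) {x y : S1}
    (hxy : s(x, y) ∈ L) (hne : s3 x ≠ s3 y) :
    (s(x + ((1/3 : ℝ) : S1), y + ((1/3 : ℝ) : S1)) ∈ L ∧
      s(x + ((2/3 : ℝ) : S1), y + ((2/3 : ℝ) : S1)) ∈ L) ∨
    (s(x + ((1/3 : ℝ) : S1), y + ((2/3 : ℝ) : S1)) ∈ L ∧
      s(x + ((2/3 : ℝ) : S1), y + ((1/3 : ℝ) : S1)) ∈ L) := by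
  obtain ⟨ℓ₂, h₂, ℓ₃, h₃, d12, d13, d23, -, e2, e3⟩ := hL.siblings _ hxy
    (by simpa [cmap] using hne)
  obtain ⟨x₂, y₂, rfl, hx₂, hy₂⟩ := exists_rep_of_cmap_eq e2
  obtain ⟨x₃, y₃, rfl, hx₃, hy₃⟩ := exists_rep_of_cmap_eq e3
  have a1 : x₂ ≠ x := (ne_of_disjoint d12 (by simp) (by simp)).symm
  have a2 : x₃ ≠ x := (ne_of_disjoint d13 (by simp) (by simp)).symm
  have a3 : x₂ ≠ x₃ := ne_of_disjoint d23 (by simp) (by simp)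
  have b1 : y₂ ≠ y := (ne_of_disjoint d12 (by simp) (by simp)).symm
  have b2 : y₃ ≠ y := (ne_of_disjoint d13 (by simp) (by simp)).symm
  have b3 : y₂ ≠ y₃ := ne_of_disjoint d23 (by simp) (by simp)
  rcases eq_add_third_of_s3_eq hx₂ a1 with rfl | rfl <;>
  rcases eq_add_third_of_s3_eq hx₃ a2 with rfl | rfl <;>
  rcases eq_add_third_of_s3_eq hy₂ b1 with rfl | rfl <;>
  rcases eq_add_third_of_s3_eq hy₃ b2 with rfl | rfl <;>
  first
    | exact absurd rfl a3
    | exact absurd rfl b3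
    | exact Or.inl ⟨h₂, h₃⟩
    | exact Or.inl ⟨h₃, h₂⟩
    | exact Or.inr ⟨h₂, h₃⟩
    | exact Or.inr ⟨h₃, h₂⟩

lemma IsCubicSymLam.s3_mem {L : Set Chord} (hL : IsCubicSymLam L) {x y : S1}
    (hxy : s(x, y) ∈ L) (hne : s3 x ≠ s3 y) : s(s3 x, s3 y) ∈ L :=
  (hL.forward _ hxy).resolve_right (by simpa [cmap] using hne)

lemma IsCubicSymLam.antip_mem {L : Set Chord} (hL : IsCubicSymLam L) {x y : S1}
    (hxy : s(x, y) ∈ L) : s(antip x, antip y) ∈ L := hL.symm _ hxy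

lemma fract_eq_sub {r : ℝ} {n : ℤ} (h0 : (n : ℝ) ≤ r) (h1 : r < n + 1) :
    Int.fract r = r - n := by
  rw [Int.fract, Int.floor_eq_iff.2 ⟨h0, h1⟩]

open Classical in
/-- The number of points `b + 1/3`, `b + 2/3` in the arc `(0, α)`, when `b` is outside of it. -/
lemma count_thirds {α b : ℝ} (hα0 : 0 < α) (hα1 : α < 1) (hb0 : 0 ≤ b) (hb1 : b < 1)
    (hb : b = 0 ∨ α ≤ b) (hα : 0 < Int.fract (3 * α)) :
    ((if 0 < Int.fract (b + 1/3) ∧ Int.fract (b + 1/3) < α then 1 else 0) +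
     (if 0 < Int.fract (b + 2/3) ∧ Int.fract (b + 2/3) < α then 1 else 0) : ℤ) =
    ⌊3 * α⌋ + (if 0 < Int.fract (3 * b) ∧ Int.fract (3 * b) < Int.fract (3 * α) then 1 else 0) := by
  obtain ⟨i, hi⟩ : ∃ i : ℤ, ⌊3 * α⌋ = i := ⟨_, rfl⟩
  obtain ⟨j, hj⟩ : ∃ j : ℤ, ⌊3 * b⌋ = j := ⟨_, rfl⟩
  rw [← Int.self_sub_floor] at hα
  rw [← Int.self_sub_floor (3 * α), ← Int.self_sub_floor (3 * b), hj]
  rw [hi] at hα ⊢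
  obtain ⟨i1, i2⟩ := Int.floor_eq_iff.1 hi
  obtain ⟨j1, j2⟩ := Int.floor_eq_iff.1 hj
  have i0 : 0 ≤ i := by rw [← hi]; exact Int.floor_nonneg.2 (by linarith)
  have j0 : 0 ≤ j := by rw [← hj]; exact Int.floor_nonneg.2 (by linarith)
  have i3 : i < 3 := by have : (i:ℝ) < 3 := by linarith
                        exact_mod_cast this
  have j3 : j < 3 := by have : (j:ℝ) < 3 := by linarith
                        exact_mod_cast this
  have f1 : Int.fract (b + 1/3) = if j < 2 then b + 1/3 else b - 2/3 := by
    split_ifs with h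
    · have : (j:ℝ) ≤ 1 := by exact_mod_cast (by omega : j ≤ 1)
      rw [Int.fract_eq_self]; constructor <;> linarith
    · have : (2:ℝ) ≤ j := by exact_mod_cast (by omega : 2 ≤ j)
      rw [fract_eq_sub (n := 1)] <;> push_cast <;> linarith
  have f2 : Int.fract (b + 2/3) = if j < 1 then b + 2/3 else b - 1/3 := by
    split_ifs with h
    · have : (j:ℝ) ≤ 0 := by exact_mod_cast (by omega : j ≤ 0)
      rw [Int.fract_eq_self]; constructor <;> linarith
    · have : (1:ℝ) ≤ j := by exact_mod_cast (by omega : 1 ≤ j)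
      rw [fract_eq_sub (n := 1)] <;> push_cast <;> linarith
  rw [f1, f2]
  clear f1 f2 hi hj
  interval_cases i <;> interval_cases j <;> norm_num at hα i1 i2 j1 j2 ⊢ <;>
  rcases hb with rfl | hb <;> split_ifs <;> first | rfl | (exfalso; grind)

/-- A leaf with endpoints outside of `W` has both or none of them behind a given hole of `W`. -/
lemma behind_hole_iff {L : Set Chord} (hL : Unlinked L) {W : Set S1} {u v z w : S1}
    (huv : IsHole W u v) (hWL : s(u, v) ∈ L) (hzw : s(z, w) ∈ L) (hz : z ∉ W) (hw : w ∉ W) :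
    (0 < arcLen u z ∧ arcLen u z < arcLen u v) ↔ (0 < arcLen u w ∧ arcLen u w < arcLen u v) := by
  have key : ∀ z w, s(z, w) ∈ L → z ∉ W → w ∉ W →
      (0 < arcLen u z ∧ arcLen u z < arcLen u v) →
      (0 < arcLen u w ∧ arcLen u w < arcLen u v) := by
    rintro z w hzw hz hw ⟨h1, h2⟩
    refine ⟨arcLen_pos.2 fun h => hw (h ▸ huv.left_mem), ?_⟩
    by_contra! h3
    have h4 : arcLen u v ≠ arcLen u w := fun h => hw (arcLen_left_inj h ▸ huv.right_mem)
    exact hL.false_of_arcLen hWL hzw h1 h2 (lt_of_le_of_ne h3 h4)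
  exact ⟨key z w hzw hz hw, key w z (Sym2.eq_swap ▸ hzw) hw hz⟩

lemma arcLen_add_right (u x : S1) (r : ℝ) :
    arcLen u (x + (r : S1)) = Int.fract (arcLen u x + r) := by
  have h := arcLen_add_add u 0 (arcLen u x + r)
  rw [AddCircle.coe_add, ← add_assoc, add_arcLen] at h
  simpa using h

/-- On a finite set whose consecutive pairs are leaves and on which `s3` is injective, `s3` maps
consecutive pairs to consecutive pairs. -/
lemma IsHole.map_s3 {L : Set Chord} (hL : IsCubicSymLam L) {W : Set S1} (hW : W.Finite)
    (hWL : ∀ u v, IsHole W u v → s(u, v) ∈ L) (hinj : InjOn s3 W) {u v : S1}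
    (huv : IsHole W u v) : IsHole (s3 '' W) (s3 u) (s3 v) := by
  have hne : s3 u ≠ s3 v := fun h => huv.ne (hinj huv.left_mem huv.right_mem h)
  refine ⟨mem_image_of_mem _ huv.left_mem, mem_image_of_mem _ huv.right_mem, hne, ?_⟩
  suffices h : ∀ x ∈ W, ¬ (0 < arcLen (s3 u) (s3 x) ∧ arcLen (s3 u) (s3 x) < arcLen (s3 u) (s3 v)) by
    rintro _ ⟨x, hx, rfl⟩ hxu
    by_contra! hlt
    exact h x hx ⟨arcLen_pos.2 hxu.symm, hlt⟩
  refine forall_mem_of_hole_step hW _ huv.left_mem (by rw [arcLen_self]; simp) ?_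
  intro x y hxy hx hy
  have hα := arcLen_pos.2 hne
  rw [arcLen_s3] at hx hy hα
  rw [arcLen_s3] at hx hy
  have hnot : ∀ x ∈ W, ∀ z, s3 z = s3 x → z ≠ x → z ∉ W := fun x hx z h1 h2 h3 =>
    h2 (hinj h3 hx h1)
  have hpos : ∀ x ∈ W, arcLen u x = 0 ∨ arcLen u v ≤ arcLen u x := fun x hx => by
    by_cases h : x = u
    · left; rw [h, arcLen_self]
    · right; exact huv.le x hx h
  have cx := count_thirds (arcLen_pos.2 huv.ne) (arcLen_lt_one _ _) (arcLen_nonneg u x)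
    (arcLen_lt_one _ _) (hpos x hxy.left_mem) hα
  have cy := count_thirds (arcLen_pos.2 huv.ne) (arcLen_lt_one _ _) (arcLen_nonneg u y)
    (arcLen_lt_one _ _) (hpos y hxy.right_mem) hα
  rw [if_neg hx, ← arcLen_add_right, ← arcLen_add_right] at cx
  rw [if_pos hy, ← arcLen_add_right, ← arcLen_add_right] at cy
  have hx1 := hnot x hxy.left_mem _ (s3_add_third x) (add_coe_ne x (by norm_num) (by norm_num))
  have hx2 := hnot x hxy.left_mem _ (s3_add_two_thirds x) (add_coe_ne x (by norm_num) (by norm_num))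
  have hy1 := hnot y hxy.right_mem _ (s3_add_third y) (add_coe_ne y (by norm_num) (by norm_num))
  have hy2 := hnot y hxy.right_mem _ (s3_add_two_thirds y) (add_coe_ne y (by norm_num) (by norm_num))
  have hxy' : s3 x ≠ s3 y := fun h => hxy.ne (hinj hxy.left_mem hxy.right_mem h)
  rcases hL.sibling_cases (hWL _ _ hxy) hxy' with ⟨s1, s2⟩ | ⟨s1, s2⟩
  · have e1 := behind_hole_iff hL.unlinked huv (hWL _ _ huv) s1 hx1 hy1
    have e2 := behind_hole_iff hL.unlinked huv (hWL _ _ huv) s2 hx2 hy2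
    simp only [e1, e2] at cx
    omega
  · have e1 := behind_hole_iff hL.unlinked huv (hWL _ _ huv) s1 hx1 hy2
    have e2 := behind_hole_iff hL.unlinked huv (hWL _ _ huv) s2 hx2 hy1
    simp only [e1, e2] at cx
    omega

/-- If every hole of `W` maps to a hole of `f '' W`, then all holes of `f '' W` arise this way. -/
lemma exists_hole_of_image {W : Set S1} (hW : W.Finite) {f : S1 → S1}
    (hf : ∀ u v, IsHole W u v → IsHole (f '' W) (f u) (f v)) {a b : S1}
    (hab : IsHole (f '' W) a b) : ∃ u v, IsHole W u v ∧ a = f u ∧ b = f v := by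
  obtain ⟨u, hu, rfl⟩ := hab.left_mem
  obtain ⟨z, hz, rfl⟩ := hab.right_mem
  obtain ⟨v, huv⟩ := exists_hole_left hW hu hz (fun h => hab.ne (by rw [h]))
  exact ⟨u, v, huv, rfl, hab.right_unique (hf u v huv)⟩

lemma IsHole.map_antip {W : Set S1} {u v : S1} (h : IsHole W u v) :
    IsHole (antip '' W) (antip u) (antip v) := by
  refine ⟨mem_image_of_mem _ h.left_mem, mem_image_of_mem _ h.right_mem,
    fun h' => h.ne (antip_injective h'), ?_⟩
  rintro _ ⟨x, hx, rfl⟩ hxu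
  rw [arcLen_antip, arcLen_antip]
  exact h.le x hx (fun h => hxu (by rw [h]))

/-- The maps `s3^[k]` and `antip ∘ s3^[k]`. -/
def IsDyn (φ : S1 → S1) : Prop := ∃ k : ℕ, φ = s3^[k] ∨ φ = antip ∘ s3^[k]

lemma isDyn_iterate (k : ℕ) : IsDyn s3^[k] := ⟨k, Or.inl rfl⟩

lemma isDyn_antip : IsDyn antip := ⟨0, Or.inr rfl⟩

lemma isDyn_id : IsDyn id := ⟨0, Or.inl rfl⟩

lemma antip_comp_iterate (k : ℕ) : s3^[k] ∘ antip = antip ∘ s3^[k] :=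
  funext (iterate_s3_antip k)

lemma antip_comp_antip : antip ∘ antip = id := funext antip_antip

lemma IsDyn.comp {φ ψ : S1 → S1} (hφ : IsDyn φ) (hψ : IsDyn ψ) : IsDyn (φ ∘ ψ) := by
  obtain ⟨k, rfl | rfl⟩ := hφ <;> obtain ⟨m, rfl | rfl⟩ := hψ <;> refine ⟨k + m, ?_⟩ <;>
  rw [Function.iterate_add]
  · exact Or.inl rfl
  · right; rw [← Function.comp_assoc, antip_comp_iterate]; rfl
  · exact Or.inr rfl
  · left
    rw [Function.comp_assoc, ← Function.comp_assoc _ antip, antip_comp_iterate,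
      ← Function.comp_assoc, ← Function.comp_assoc, antip_comp_antip]; rfl

lemma IsDyn.iterate_comm {φ : S1 → S1} (hφ : IsDyn φ) (n : ℕ) (x : S1) :
    s3^[n] (φ x) = φ (s3^[n] x) := by
  obtain ⟨k, rfl | rfl⟩ := hφ
  · rw [← Function.iterate_add_apply, ← Function.iterate_add_apply, add_comm]
  · simp only [Function.comp]
    rw [iterate_s3_antip, ← Function.iterate_add_apply, ← Function.iterate_add_apply, add_comm]

lemma iterate_mul_fixed {N : ℕ} {x : S1} (h : s3^[N] x = x) (k : ℕ) : s3^[N * k] x = x := by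
  rw [Function.iterate_mul]
  exact Function.iterate_fixed h k

lemma iterate_cancel {N : ℕ} (hN : 1 ≤ N) (k : ℕ) {x : S1} (hx : s3^[N] x = x) :
    s3^[N * k - k] (s3^[k] x) = x := by
  rw [← Function.iterate_add_apply, Nat.sub_add_cancel (Nat.le_mul_of_pos_left k hN),
    iterate_mul_fixed hx]

/-- Every dynamical map is inverted by another one on points of period dividing `N`. -/
lemma IsDyn.exists_inverse {N : ℕ} (hN : 1 ≤ N) {φ : S1 → S1} (hφ : IsDyn φ) :
    ∃ ψ, IsDyn ψ ∧ ∀ x, s3^[N] x = x → ψ (φ x) = x := by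
  obtain ⟨k, hk⟩ := hφ
  rcases hk with rfl | rfl
  · exact ⟨_, isDyn_iterate _, fun _ => iterate_cancel hN k⟩
  · refine ⟨antip ∘ s3^[N * k - k], isDyn_antip.comp (isDyn_iterate _), fun x hx => ?_⟩
    simp only [Function.comp]
    rw [iterate_s3_antip, antip_antip, iterate_cancel hN k hx]

lemma s3_injOn_periodic {N : ℕ} (hN : 1 ≤ N) {x y : S1} (hx : s3^[N] x = x) (hy : s3^[N] y = y)
    (h : s3 x = s3 y) : x = y := by
  obtain ⟨ψ, -, hψ⟩ := (isDyn_iterate 1).exists_inverse hN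
  rw [← hψ x hx, ← hψ y hy]
  exact congrArg ψ h

lemma IsDyn.injOn_periodic {N : ℕ} (hN : 1 ≤ N) {φ : S1 → S1} (hφ : IsDyn φ) {x y : S1}
    (hx : s3^[N] x = x) (hy : s3^[N] y = y) (h : φ x = φ y) : x = y := by
  obtain ⟨ψ, -, hψ⟩ := hφ.exists_inverse hN
  rw [← hψ x hx, ← hψ y hy, h]

lemma IsDyn.leaf_mem {L : Set Chord} (hL : IsCubicSymLam L) {N : ℕ} (hN : 1 ≤ N) {φ : S1 → S1}
    (hφ : IsDyn φ) {x y : S1} (hx : s3^[N] x = x) (hy : s3^[N] y = y) (hne : x ≠ y)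
    (hxy : s(x, y) ∈ L) : s(φ x, φ y) ∈ L := by
  have key : ∀ k, s(s3^[k] x, s3^[k] y) ∈ L := by
    intro k
    induction k with
    | zero => exact hxy
    | succ k ih =>
      have h := fun h => hne ((isDyn_iterate (k + 1)).injOn_periodic hN hx hy h)
      rw [Function.iterate_succ_apply', Function.iterate_succ_apply'] at h ⊢
      exact hL.s3_mem ih h
  obtain ⟨k, rfl | rfl⟩ := hφ
  · exact key k
  · exact hL.antip_mem (key k)

lemma IsPolygon.map_hole {L : Set Chord} (hL : IsCubicSymLam L) {N : ℕ} (hN : 1 ≤ N) {W : Set S1}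
    (hW : IsPolygon L N W) {φ : S1 → S1} (hφ : IsDyn φ) {u v : S1} (huv : IsHole W u v) :
    IsHole (φ '' W) (φ u) (φ v) := by
  have key : ∀ k, ∀ u v, IsHole W u v → IsHole (s3^[k] '' W) (s3^[k] u) (s3^[k] v) := by
    intro k
    induction k with
    | zero => intro u v h; simpa using h
    | succ k ih =>
      intro u v h
      have hper : ∀ x ∈ s3^[k] '' W, s3^[N] x = x := by
        rintro _ ⟨x, hx, rfl⟩
        rw [(isDyn_iterate k).iterate_comm, hW.periodic x hx]
      rw [Function.iterate_succ', image_comp]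
      refine (ih u v h).map_s3 hL (hW.finite.image _) ?_
        (fun x hx y hy h => s3_injOn_periodic hN (hper x hx) (hper y hy) h)
      intro a b hab
      obtain ⟨u, v, huv, rfl, rfl⟩ := exists_hole_of_image hW.finite ih hab
      exact (isDyn_iterate k).leaf_mem hL hN (hW.periodic _ huv.left_mem)
        (hW.periodic _ huv.right_mem) huv.ne (hW.hole_mem _ _ huv)
  obtain ⟨k, rfl | rfl⟩ := hφ
  · exact key k u v huv
  · rw [image_comp]; exact (key k u v huv).map_antip

lemma IsPolygon.image {L : Set Chord} (hL : IsCubicSymLam L) {N : ℕ} (hN : 1 ≤ N) {W : Set S1}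
    (hW : IsPolygon L N W) {φ : S1 → S1} (hφ : IsDyn φ) : IsPolygon L N (φ '' W) := by
  have hper : ∀ x ∈ φ '' W, s3^[N] x = x := by
    rintro _ ⟨x, hx, rfl⟩
    rw [hφ.iterate_comm, hW.periodic x hx]
  obtain ⟨ψ, hψ, hψφ⟩ := hφ.exists_inverse hN
  refine ⟨hW.finite.image _, ?_, ?_, ?_, hper⟩
  · intro x y
    obtain ⟨z, hz, h1, h2⟩ := hW.third (ψ x) (ψ y)
    refine ⟨φ z, mem_image_of_mem _ hz, ?_, ?_⟩
    · rintro rfl; exact h1 (hψφ z (hW.periodic z hz)).symm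
    · rintro rfl; exact h2 (hψφ z (hW.periodic z hz)).symm
  · intro a b hab
    obtain ⟨u, v, huv, rfl, rfl⟩ :=
      exists_hole_of_image hW.finite (fun u v h => hW.map_hole hL hN hφ h) hab
    exact hφ.leaf_mem hL hN (hW.periodic _ huv.left_mem)
        (hW.periodic _ huv.right_mem) huv.ne (hW.hole_mem _ _ huv)
  · rintro _ ⟨u, hu, rfl⟩ _ ⟨v, hv, rfl⟩ hne hmem
    have h := hψ.leaf_mem hL hN (hper _ (mem_image_of_mem _ hu)) (hper _ (mem_image_of_mem _ hv))
      hne hmem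
    rw [hψφ u (hW.periodic u hu), hψφ v (hW.periodic v hv)] at h
    exact (hW.diag u hu v hv (fun h => hne (by rw [h])) h).imp (hW.map_hole hL hN hφ)
      (hW.map_hole hL hN hφ)

lemma Unlinked.false_of_add {L : Set Chord} (hL : Unlinked L) (w : S1) {a b c d : ℝ}
    (h1 : a < b) (h2 : b < c) (h3 : c < d) (h4 : d < a + 1)
    (hac : s(w + (a : S1), w + (c : S1)) ∈ L) (hbd : s(w + (b : S1), w + (d : S1)) ∈ L) : False :=
  hL _ hac _ hbd (crosses_add w h1 h2 h3 h4)

lemma add_coe_add (w : S1) (a b : ℝ) : w + (a : S1) + (b : S1) = w + ((a + b : ℝ) : S1) := by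
  rw [add_assoc, ← AddCircle.coe_add]

lemma add_coe_add_one (w : S1) (a : ℝ) : w + ((a + 1 : ℝ) : S1) = w + (a : S1) := by
  have := coe_add_int a 1
  rw [Int.cast_one] at this
  rw [this]

/-- A leaf with a short but not longer-than-itself image comes with a pair of leaves bounding
a critical strip. -/
lemma IsCubicSymLam.exists_strip {L : Set Chord} (hL : IsCubicSymLam L) {x y : S1}
    (hxy : s(x, y) ∈ L) (h0 : 0 < arcLen (s3 x) (s3 y)) (h1 : arcLen (s3 x) (s3 y) < 1/2)
    (hle : arcLen (s3 x) (s3 y) ≤ arcLen x y) :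
    ∃ (w : S1) (ε : ℝ), 0 < ε ∧ ε < 1/6 ∧ arcLen (s3 x) (s3 y) = 3 * ε ∧ s3 w = s3 x ∧
      s(w + ((0 : ℝ) : S1), w + ((1/3 + ε : ℝ) : S1)) ∈ L ∧
      s(w + (ε : S1), w + ((1/3 : ℝ) : S1)) ∈ L := by
  have hne : s3 x ≠ s3 y := arcLen_pos.1 h0
  have hsib := hL.sibling_cases hxy hne
  rw [arcLen_s3] at h0 h1 hle ⊢
  have hα0 := arcLen_nonneg x y
  have hα1 := arcLen_lt_one x y
  have hy := add_arcLen x y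
  generalize arcLen x y = α at *
  subst hy
  simp only [add_coe_add] at hsib
  have hxy' : s(x + ((0 : ℝ) : S1), x + (α : S1)) ∈ L := by simpa using hxy
  rcases lt_or_ge α (1/3) with hlt | hge
  · rw [fract_eq_sub (n := 0) (by push_cast; linarith) (by push_cast; linarith)] at *
    push_cast at *
    linarith
  rcases lt_or_ge α (2/3) with hlt' | hge'
  · rw [fract_eq_sub (n := 1) (by push_cast; linarith) (by push_cast; linarith)] at *
    push_cast at *
    refine ⟨x, α - 1/3, by linarith, by linarith, by ring, rfl, ?_, ?_⟩
    · rwa [add_sub_cancel]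
    rcases hsib with ⟨h, -⟩ | ⟨h, -⟩
    · exact (hL.unlinked.false_of_add x (by linarith) (by linarith) (by linarith)
        (by linarith) hxy' h).elim
    · have e1 : x + ((α + 2/3 : ℝ) : S1) = x + ((α - 1/3 : ℝ) : S1) := by
        rw [← add_coe_add_one x (α - 1/3)]; congr 2; ring
      rwa [e1, Sym2.eq_swap] at h
  · rw [fract_eq_sub (n := 2) (by push_cast; linarith) (by push_cast; linarith)] at *
    push_cast at *
    have e1 : x + ((1 : ℝ) : S1) = x := by
      simp
    have e2 : x + ((α + 1/3 : ℝ) : S1) = x + ((α - 2/3 : ℝ) : S1) := by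
      rw [← add_coe_add_one x (α - 2/3)]; congr 2; ring
    refine ⟨x + ((2/3 : ℝ) : S1), α - 2/3, by linarith, by linarith, by ring,
      s3_add_two_thirds x, ?_, ?_⟩
    · rcases hsib with ⟨h, -⟩ | ⟨-, h⟩
      · have h' := hL.antip_mem hxy
        rw [e2, Sym2.eq_swap] at h
        rw [Sym2.eq_swap] at h'
        unfold antip at h'
        rw [add_coe_add] at h'
        have e3 : x + ((α + 1/2 : ℝ) : S1) = x + ((α - 1/2 : ℝ) : S1) := by
          rw [← add_coe_add_one x (α - 1/2)]; congr 2; ring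
        rw [e3] at h'
        exact (hL.unlinked.false_of_add x (by linarith) (by linarith) (by linarith)
          (by linarith) h h').elim
      · rw [add_coe_add, add_zero]
        rwa [show (2/3 + (1/3 + (α - 2/3)) : ℝ) = α + 1/3 by ring]
    · rw [add_coe_add, add_coe_add, add_sub_cancel, show (2/3 + 1/3 : ℝ) = 1 by norm_num, e1,
        Sym2.eq_swap]
      exact hxy

/-- Of two critical strips, the narrower one lies next to the wider one or its antipode. -/
lemma IsCubicSymLam.strip_nested {L : Set Chord} (hL : IsCubicSymLam L) {w₁ w₂ : S1} {ε₁ ε₂ : ℝ}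
    (h0 : 0 < ε₁) (hle : ε₁ ≤ ε₂) (h1 : ε₂ < 1/6)
    (hA₁ : s(w₁ + ((0 : ℝ) : S1), w₁ + ((1/3 + ε₁ : ℝ) : S1)) ∈ L)
    (hA : s(w₂ + ((0 : ℝ) : S1), w₂ + ((1/3 + ε₂ : ℝ) : S1)) ∈ L)
    (hB : s(w₂ + (ε₂ : S1), w₂ + ((1/3 : ℝ) : S1)) ∈ L) :
    arcLen w₂ w₁ ≤ ε₂ - ε₁ ∨ arcLen (antip w₂) w₁ ≤ ε₂ - ε₁ := by
  have key : ∀ w : S1, s(w + ((0 : ℝ) : S1), w + ((1/3 + ε₂ : ℝ) : S1)) ∈ L →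
      s(w + (ε₂ : S1), w + ((1/3 : ℝ) : S1)) ∈ L → arcLen w w₁ < 1/2 →
      arcLen w w₁ ≤ ε₂ - ε₁ := by
    intro w hA hB hr
    have hr0 := arcLen_nonneg w w₁
    have hw := add_arcLen w w₁
    generalize arcLen w w₁ = r at *
    subst hw
    rw [add_coe_add, add_coe_add, add_zero] at hA₁
    by_contra! hgt
    rcases hr0.eq_or_lt with rfl | hr0
    · linarith
    rcases le_or_gt r ε₂ with h2 | h2
    · exact hL.unlinked.false_of_add w (by linarith) (by linarith) (by linarith) (by linarith)
        hA hA₁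
    rcases lt_or_ge r (1/3) with h3 | h3
    · exact hL.unlinked.false_of_add w (by linarith) (by linarith) (by linarith) (by linarith)
        hB hA₁
    rcases lt_or_ge r (1/3 + ε₂) with h4 | h4
    · exact hL.unlinked.false_of_add w (by linarith) (by linarith) (by linarith) (by linarith)
        hA hA₁
    · have hA' := hL.antip_mem hA
      unfold antip at hA'
      rw [add_coe_add, add_coe_add] at hA'
      exact hL.unlinked.false_of_add w (by linarith) (by linarith) (by linarith) (by linarith)
        hA₁ hA'
  rcases lt_or_ge (arcLen w₂ w₁) (1/2) with h | h
  · exact Or.inl (key w₂ hA hB h)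
  · right
    have hanti : ∀ r : ℝ, antip (w₂ + (r : S1)) = antip w₂ + (r : S1) := fun r => by
      unfold antip; rw [add_right_comm]
    refine key _ ?_ ?_ ?_
    · simpa only [hanti] using hL.antip_mem hA
    · simpa only [hanti] using hL.antip_mem hB
    · have h3 := arcLen_of_base w₂ (antip w₂) w₁
      have h4 : arcLen w₂ (antip w₂) = 1/2 := arcLen_add_of_mem w₂ (by norm_num) (by norm_num)
      have h5 := arcLen_lt_one w₂ w₁
      rw [h4] at h3
      rcases h3 with h3 | h3 <;> linarith

/-- Two leaves with short images, one of them no longer than the other, and neither shorter than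
its image: then the smaller image lies under the larger one or under its antipode. -/
lemma IsCubicSymLam.image_nested {L : Set Chord} (hL : IsCubicSymLam L) {x₁ y₁ x₂ y₂ : S1}
    (hxy₁ : s(x₁, y₁) ∈ L) (hxy₂ : s(x₂, y₂) ∈ L) (h0 : 0 < arcLen (s3 x₁) (s3 y₁))
    (hle : arcLen (s3 x₁) (s3 y₁) ≤ arcLen (s3 x₂) (s3 y₂)) (h1 : arcLen (s3 x₂) (s3 y₂) < 1/2)
    (hle₁ : arcLen (s3 x₁) (s3 y₁) ≤ arcLen x₁ y₁)
    (hle₂ : arcLen (s3 x₂) (s3 y₂) ≤ arcLen x₂ y₂) :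
    ∃ σ : S1 → S1, (σ = id ∨ σ = antip) ∧ arcLen (σ (s3 x₂)) (s3 x₁) + arcLen (s3 x₁) (s3 y₁) ≤
      arcLen (s3 x₂) (s3 y₂) := by
  obtain ⟨w₁, ε₁, h2, h3, h4, h5, hA₁, hB₁⟩ := hL.exists_strip hxy₁ h0 (by linarith) hle₁
  obtain ⟨w₂, ε₂, h6, h7, h8, h9, hA₂, hB₂⟩ := hL.exists_strip hxy₂ (by linarith) h1 hle₂
  have key : ∀ w, arcLen w w₁ ≤ ε₂ - ε₁ → arcLen (s3 w) (s3 w₁) = 3 * arcLen w w₁ := by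
    intro w hw
    have := arcLen_nonneg w w₁
    rw [arcLen_s3, Int.fract_eq_self.2 ⟨by linarith, by linarith⟩]
  rcases hL.strip_nested h2 (by linarith) h7 hA₁ hA₂ hB₂ with h | h
  · refine ⟨id, Or.inl rfl, ?_⟩
    have := key _ h
    rw [h9, h5] at this
    rw [id, this]; linarith
  · refine ⟨antip, Or.inr rfl, ?_⟩
    have := key _ h
    rw [s3_antip, h9, h5] at this
    rw [this]; linarith

lemma IsPolygon.exists_hole {L : Set Chord} {N : ℕ} {W : Set S1} (hW : IsPolygon L N W) {u : S1}
    (hu : u ∈ W) : ∃ v, IsHole W u v := by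
  obtain ⟨z, hz, hzu, -⟩ := hW.third u u
  exact exists_hole_left hW.finite hu hz hzu

lemma IsPolygon.arcLen_add_lt_one {L : Set Chord} {N : ℕ} {W : Set S1} (hW : IsPolygon L N W)
    {x y x' y' : S1} (h : IsHole W x y) (h' : IsHole W x' y') (hne : x ≠ x') :
    arcLen x y + arcLen x' y' < 1 := by
  have h1 := h.le x' h'.left_mem hne.symm
  have h2 := h'.le x h.left_mem hne
  have h3 := arcLen_of_base x x' x
  have h4 := arcLen_self x
  have h5 := arcLen_pos.2 hne
  by_contra! hge
  have h6 : y = x' := arcLen_left_inj (x := x) (by rcases h3 with h3 | h3 <;> linarith)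
  have h7 : y' = x := arcLen_left_inj (x := x') (by rcases h3 with h3 | h3 <;> linarith)
  subst h6 h7
  obtain ⟨z, hz, hz1, hz2⟩ := hW.third y' y
  rcases eq_or_eq_of_holes h h' hz with h | h
  · exact hz1 h
  · exact hz2 h

lemma iterate_mod_of_fixed {N : ℕ} {x : S1} (h : s3^[N] x = x) (k : ℕ) :
    s3^[k % N] x = s3^[k] x := by
  conv_rhs => rw [← Nat.mod_add_div k N, Function.iterate_add_apply, iterate_mul_fixed h]

lemma exists_min_iterate {N : ℕ} (hN : 1 ≤ N) {x y : S1} (hx : s3^[N] x = x)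
    (hy : s3^[N] y = y) :
    ∃ i, ∀ j, arcLen (s3^[i] x) (s3^[i] y) ≤ arcLen (s3^[j] x) (s3^[j] y) := by
  obtain ⟨i, -, hi⟩ := Finset.exists_min_image (Finset.range N)
    (fun i => arcLen (s3^[i] x) (s3^[i] y)) ⟨0, Finset.mem_range.2 hN⟩
  refine ⟨i, fun j => ?_⟩
  have := hi (j % N) (Finset.mem_range.2 (Nat.mod_lt _ hN))
  rwa [iterate_mod_of_fixed hx, iterate_mod_of_fixed hy] at this

lemma IsDyn.exists_arcLen_eq {φ : S1 → S1} (hφ : IsDyn φ) :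
    ∃ k, ∀ x y, arcLen (φ x) (φ y) = arcLen (s3^[k] x) (s3^[k] y) := by
  obtain ⟨k, rfl | rfl⟩ := hφ
  · exact ⟨k, fun _ _ => rfl⟩
  · exact ⟨k, fun _ _ => arcLen_antip _ _⟩

/-- The hole `(a, b)` of `W` is shortest among all dynamical images of holes of `W`. -/
structure IsMinHole (W : Set S1) (a b : S1) : Prop extends IsHole W a b where
  min : ∀ φ, IsDyn φ → ∀ x y, IsHole W x y → arcLen a b ≤ arcLen (φ x) (φ y)

lemma IsMinHole.exists_dyn_or_long {L : Set Chord} (hL : IsCubicSymLam L) {N : ℕ} (hN : 1 ≤ N)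
    {W : Set S1} (hW : IsPolygon L N W) {a b : S1} (hab : IsMinHole W a b) {x y : S1}
    (hxy : IsHole W x y) :
    (∃ φ, IsDyn φ ∧ φ x = a ∧ φ y = b) ∨
      ∀ φ, IsDyn φ → IsHole W (φ x) (φ y) → 1/2 ≤ arcLen (φ x) (φ y) := by
  rw [or_iff_not_imp_left]
  intro hno φ hφ hφh
  by_contra! hlt
  have hx := hW.periodic x hxy.left_mem
  have hy := hW.periodic y hxy.right_mem
  obtain ⟨i, hi⟩ := exists_min_iterate hN hx hy
  have hφi : arcLen (s3^[i] x) (s3^[i] y) ≤ arcLen (φ x) (φ y) := by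
    obtain ⟨k, hk⟩ := hφ.exists_arcLen_eq
    rw [hk]; exact hi k
  have hpre : ∀ j z, s3^[N] z = z → s3 (s3^[j + (N - 1)] z) = s3^[j] z := fun j z hz => by
    rw [← Function.iterate_succ_apply' s3, show (j + (N - 1)).succ = j + N by omega,
      Function.iterate_add_apply, hz]
  have ha := hpre 0 a (hW.periodic a hab.left_mem)
  have hb := hpre 0 b (hW.periodic b hab.right_mem)
  rw [Function.iterate_zero, id] at ha hb
  have hleaf := fun k => (isDyn_iterate k).leaf_mem hL hN hx hy hxy.ne (hW.hole_mem _ _ hxy)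
  have hleaf' := fun k => (isDyn_iterate k).leaf_mem hL hN (hW.periodic a hab.left_mem)
    (hW.periodic b hab.right_mem) hab.ne (hW.hole_mem _ _ hab.toIsHole)
  have hnest := hL.image_nested (hleaf' (0 + (N - 1))) (hleaf (i + (N - 1)))
  rw [ha, hb, hpre i x hx, hpre i y hy] at hnest
  obtain ⟨σ, hσ, hle⟩ := hnest (arcLen_pos.2 hab.ne) (hab.min _ (isDyn_iterate i) _ _ hxy)
    (by linarith) (hab.min _ (isDyn_iterate _) _ _ hab.toIsHole) (hi _)
  have hσd : IsDyn σ := by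
    rcases hσ with rfl | rfl
    exacts [isDyn_id, isDyn_antip]
  have hσl : arcLen (σ (s3^[i] x)) (σ (s3^[i] y)) = arcLen (s3^[i] x) (s3^[i] y) := by
    rcases hσ with rfl | rfl
    exacts [rfl, arcLen_antip _ _]
  have hd := hσd.comp (isDyn_iterate i)
  have hce := hd.leaf_mem hL hN hx hy hxy.ne (hW.hole_mem _ _ hxy)
  rw [Function.comp, Function.comp] at hce
  rw [← hσl] at hle hφi
  rcases hW.eq_or_subset_of_hole_le hL.unlinked hab.toIsHole hce hle with ⟨h1, h2⟩ | hsub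
  · exact hno ⟨_, hd, h1.symm, h2.symm⟩
  · have h1 := hsub _ hφh.left_mem
    have h2 := hsub _ hφh.right_mem
    have h3 := arcLen_nonneg (σ (s3^[i] x)) (φ x)
    rcases arcLen_of_base (σ (s3^[i] x)) (φ x) (φ y) with h4 | h4
    · have h5 : φ y = σ (s3^[i] y) := arcLen_left_inj (x := σ (s3^[i] x)) (by linarith)
      have h6 : σ (s3^[i] x) = φ x := arcLen_eq_zero.1 (by linarith)
      obtain ⟨z, hz, hz1, hz2⟩ := hW.third (φ x) (φ y)
      have h7 := hφh.le z hz hz1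
      have h8 := hsub z hz
      rw [← h5, h6] at h8
      exact hz2 (arcLen_left_inj (le_antisymm h8 h7))
    · have := arcLen_nonneg (σ (s3^[i] x)) (φ y)
      linarith

lemma IsMinHole.exists_dyn {L : Set Chord} (hL : IsCubicSymLam L) {N : ℕ} (hN : 1 ≤ N)
    {W : Set S1} (hW : IsPolygon L N W) {a b : S1} (hab : IsMinHole W a b) {x y : S1}
    (hxy : IsHole W x y) : ∃ φ, IsDyn φ ∧ φ x = a ∧ φ y = b := by
  by_contra hno
  have hlong := (hab.exists_dyn_or_long hL hN hW hxy).resolve_left hno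
  have hxy2 : 1/2 ≤ arcLen x y := hlong id isDyn_id hxy
  obtain ⟨c, hc, hca, hcx⟩ := hW.third a x
  obtain ⟨c', hcc'⟩ := hW.exists_hole hc
  obtain ⟨φ, hφ, hφa, hφb⟩ : ∃ φ, IsDyn φ ∧ φ c = a ∧ φ c' = b := by
    refine (hab.exists_dyn_or_long hL hN hW hcc').resolve_right fun h => ?_
    have h1 : 1/2 ≤ arcLen c c' := h id isDyn_id hcc'
    linarith [hW.arcLen_add_lt_one hcc' hxy hcx]
  have himg : φ '' W = W := by
    have h := hW.map_hole hL hN hφ hcc'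
    rw [hφa, hφb] at h
    exact (hW.image hL hN hφ).eq_of_hole hL.unlinked hW h hab.toIsHole
  have hmap : ∀ u v, IsHole W u v → IsHole W (φ u) (φ v) := fun u v huv => by
    have := hW.map_hole hL hN hφ huv
    rwa [himg] at this
  have hφx : φ x = x := by
    by_contra hne
    linarith [hlong φ hφ (hmap _ _ hxy), hW.arcLen_add_lt_one (hmap _ _ hxy) hxy hne]
  have hfix := forall_mem_of_hole_step hW.finite (fun z => φ z = z) hxy.left_mem hφx
    (fun u v huv hu => by
      have h := hmap u v huv
      rw [hu] at h
      exact h.right_unique huv)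
  exact hca ((hfix c hc).symm.trans hφa)

lemma IsPolygon.exists_minHole {L : Set Chord} (hL : IsCubicSymLam L) {N : ℕ} (hN : 1 ≤ N)
    {V : Set S1} (hV : IsPolygon L N V) : ∃ i a b, IsMinHole (s3^[i] '' V) a b := by
  obtain ⟨u, hu, -⟩ := hV.third 0 0
  obtain ⟨v, huv⟩ := hV.exists_hole hu
  have hfin : {q : (S1 × S1) × ℕ | IsHole V q.1.1 q.1.2 ∧ q.2 < N}.Finite :=
    ((hV.finite.prod hV.finite).prod (Set.finite_Iio N)).subset
      fun q hq => ⟨⟨hq.1.left_mem, hq.1.right_mem⟩, hq.2⟩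
  obtain ⟨⟨⟨u₀, v₀⟩, i⟩, ⟨h₀, -⟩, hmin⟩ := Set.exists_min_image _
    (fun q : (S1 × S1) × ℕ => arcLen (s3^[q.2] q.1.1) (s3^[q.2] q.1.2)) hfin
    ⟨((u, v), 0), huv, hN⟩
  refine ⟨i, s3^[i] u₀, s3^[i] v₀, hV.map_hole hL hN (isDyn_iterate i) h₀, ?_⟩
  intro φ hφ x y hxy
  obtain ⟨x, y, hxy', rfl, rfl⟩ := exists_hole_of_image hV.finite
    (fun _ _ h => hV.map_hole hL hN (isDyn_iterate i) h) hxy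
  obtain ⟨k, hk⟩ := (hφ.comp (isDyn_iterate i)).exists_arcLen_eq
  have hx := hV.periodic x hxy'.left_mem
  have hy := hV.periodic y hxy'.right_mem
  have h1 := hk x y
  have h2 := hmin ((x, y), k % N) ⟨hxy', Nat.mod_lt _ hN⟩
  simp only [iterate_mod_of_fixed hx, iterate_mod_of_fixed hy] at h2
  exact h2.trans_eq h1.symm

/-- Any two holes of a periodic polygon are related by an iterate of `s3`, up to the antipodal
map. -/
lemma IsPolygon.exists_dyn_of_holes {L : Set Chord} (hL : IsCubicSymLam L) {N : ℕ} (hN : 1 ≤ N)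
    {V : Set S1} (hV : IsPolygon L N V) {x y x' y' : S1} (h : IsHole V x y)
    (h' : IsHole V x' y') : ∃ φ, IsDyn φ ∧ φ x = x' ∧ φ y = y' := by
  obtain ⟨i, a, b, hab⟩ := hV.exists_minHole hL hN
  have hi := isDyn_iterate i
  obtain ⟨ψ, hψ, hψx, hψy⟩ := hab.exists_dyn hL hN (hV.image hL hN hi) (hV.map_hole hL hN hi h)
  obtain ⟨ψ', hψ', hψx', hψy'⟩ :=
    hab.exists_dyn hL hN (hV.image hL hN hi) (hV.map_hole hL hN hi h')
  obtain ⟨χ, hχ, hinv⟩ := (hψ'.comp hi).exists_inverse hN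
  refine ⟨χ ∘ (ψ ∘ s3^[i]), hχ.comp (hψ.comp hi), ?_, ?_⟩
  · rw [← hinv x' (hV.periodic x' h'.left_mem)]
    simp only [Function.comp, hψx, hψx']
  · rw [← hinv y' (hV.periodic y' h'.right_mem)]
    simp only [Function.comp, hψy, hψy']

/-- No dynamical map carries a hole of a periodic polygon to a hole with reversed orientation. -/
lemma IsPolygon.not_reversed {L : Set Chord} (hL : IsCubicSymLam L) {N : ℕ} (hN : 1 ≤ N)
    {V : Set S1} (hV : IsPolygon L N V) {u v u' v' : S1} (h : IsHole V u v)
    (h' : IsHole V u' v') {φ : S1 → S1} (hφ : IsDyn φ) (hu : φ u = v') (hv : φ v = u') : False := by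
  obtain ⟨i, a, b, hab⟩ := hV.exists_minHole hL hN
  have hi := isDyn_iterate i
  obtain ⟨ψ, hψ, hψx, hψy⟩ := hab.exists_dyn hL hN (hV.image hL hN hi) (hV.map_hole hL hN hi h')
  have hχ : IsDyn (ψ ∘ s3^[i] ∘ φ) := hψ.comp (hi.comp hφ)
  have hba := hV.map_hole hL hN hχ h
  simp only [Function.comp, hu, hv, hψx, hψy] at hba
  have hχV := hV.image hL hN hχ
  obtain ⟨z, hz, hza, hzb⟩ := hχV.third a b
  obtain ⟨z', hz'⟩ := hχV.exists_hole hba.right_mem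
  have h1 := hz'.le z hz hza
  have h2 : arcLen b a < arcLen b z :=
    lt_of_le_of_ne (hba.le z hz hzb) fun h => hza (arcLen_left_inj h).symm
  have h3 : arcLen a z < arcLen a b := by
    have h4 := arcLen_of_base b a z
    have h5 := arcLen_of_base b a b
    have h6 := arcLen_self b
    have h7 := arcLen_lt_one b z
    have h8 := arcLen_pos.2 hba.ne
    rcases h4 with h4 | h4 <;> rcases h5 with h5 | h5 <;> linarith
  obtain ⟨p, q, hpq, rfl, rfl⟩ := exists_hole_of_image hV.finite
    (fun _ _ h => hV.map_hole hL hN hχ h) hz'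
  obtain ⟨θ, hθ, hinv⟩ := hi.exists_inverse hN
  have h9 := hab.min _ (hχ.comp hθ) _ _ (hV.map_hole hL hN hi hpq)
  simp only [Function.comp, hinv p (hV.periodic p hpq.left_mem),
    hinv q (hV.periodic q hpq.right_mem)] at h9
  simp only [Function.comp] at h1 h3
  linarith

lemma toC_coe (r : ℝ) :
    toC (r : S1) = Complex.exp (2 * Real.pi * Complex.I * (r : ℂ)) := by
  have h : toC (r : S1) = Complex.exp (2 * Real.pi * Complex.I * (arcLen 0 (r : S1) : ℂ)) := by
    unfold toC arcLen; rw [sub_zero]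
  have h0 := arcLen_coe 0 r
  rw [AddCircle.coe_zero, sub_zero] at h0
  rw [h, h0, Int.fract]
  push_cast
  rw [mul_sub, mul_comm _ ((⌊r⌋ : ℤ) : ℂ), Complex.exp_sub, Complex.exp_int_mul_two_pi_mul_I,
    div_one]

lemma toC_re (r : ℝ) : (toC (r : S1)).re = Real.cos (2 * Real.pi * r) := by
  rw [toC_coe, show (2 * Real.pi * Complex.I * (r : ℂ)) = ((2 * Real.pi * r : ℝ) : ℂ) * Complex.I
    by push_cast; ring, Complex.exp_ofReal_mul_I_re]

lemma toC_im (r : ℝ) : (toC (r : S1)).im = Real.sin (2 * Real.pi * r) := by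
  rw [toC_coe, show (2 * Real.pi * Complex.I * (r : ℂ)) = ((2 * Real.pi * r : ℝ) : ℂ) * Complex.I
    by push_cast; ring, Complex.exp_ofReal_mul_I_im]

lemma toC_re_sq_add_im_sq (x : S1) : (toC x).re ^ 2 + (toC x).im ^ 2 = 1 := by
  obtain ⟨r, rfl⟩ := QuotientAddGroup.mk_surjective x
  have h1 := toC_re r
  have h2 := toC_im r
  have h3 := Real.cos_sq_add_sin_sq (2 * Real.pi * r)
  rw [← h1, ← h2] at h3
  exact h3

lemma norm_toC (x : S1) : ‖toC x‖ = 1 := by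
  rw [← sq_eq_sq₀ (norm_nonneg _) zero_le_one, Complex.sq_norm, Complex.normSq_apply]
  linarith [toC_re_sq_add_im_sq x]

lemma toC_antip (x : S1) : toC (antip x) = -toC x := by
  obtain ⟨r, rfl⟩ := QuotientAddGroup.mk_surjective x
  have h : antip (r : S1) = ((r + 1/2 : ℝ) : S1) := by
    unfold antip; rw [AddCircle.coe_add]
  have h1 : 2 * Real.pi * (r + 1/2) = 2 * Real.pi * r + Real.pi := by ring
  change toC (antip (r : S1)) = -toC (r : S1)
  rw [h]
  apply Complex.ext
  · rw [toC_re, Complex.neg_re, toC_re, h1, Real.cos_add_pi]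
  · rw [toC_im, Complex.neg_im, toC_im, h1, Real.sin_add_pi]

/-- Twice the signed area of the triangle `toC a`, `toC b`, `z`. -/
def cr (a b : S1) (z : ℂ) : ℝ :=
  (toC b - toC a).re * (z - toC a).im - (toC b - toC a).im * (z - toC a).re

lemma cr_toC (a b x : S1) : cr a b (toC x) = 4 * Real.sin (Real.pi * arcLen a b) *
    Real.sin (Real.pi * arcLen a x) * Real.sin (Real.pi * (arcLen a x - arcLen a b)) := by
  have hb := add_arcLen a b
  have hx := add_arcLen a x
  generalize arcLen a b = s at *
  generalize arcLen a x = t at *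
  subst hb hx
  obtain ⟨r, rfl⟩ := QuotientAddGroup.mk_surjective a
  change cr (r : S1) ((r : S1) + (s : S1)) (toC ((r : S1) + (t : S1))) = _
  unfold cr
  rw [← AddCircle.coe_add, ← AddCircle.coe_add]
  simp only [Complex.sub_re, Complex.sub_im, toC_re, toC_im]
  rw [show 2 * Real.pi * (r + s) = 2 * Real.pi * r + 2 * (Real.pi * s) by ring,
    show 2 * Real.pi * (r + t) = 2 * Real.pi * r + 2 * (Real.pi * t) by ring,
    show Real.pi * (t - s) = Real.pi * t - Real.pi * s by ring]
  generalize Real.pi * s = S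
  generalize Real.pi * t = T
  generalize 2 * Real.pi * r = R
  have key : ∀ x, Real.cos (2 * x) = 1 - 2 * Real.sin x ^ 2 := fun x => by
    rw [Real.cos_two_mul, Real.cos_sq']; ring
  simp only [Real.cos_add, Real.sin_add, Real.sin_sub, key, Real.sin_two_mul]
  linear_combination 4 * Real.sin S * Real.sin T *
    (Real.sin T * Real.cos S - Real.cos T * Real.sin S) * Real.sin_sq_add_cos_sq R

lemma cr_neg_of_lt {a b x : S1} (h0 : 0 < arcLen a x) (h1 : arcLen a x < arcLen a b) :
    cr a b (toC x) < 0 := by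
  have hb := arcLen_lt_one a b
  have hπ := Real.pi_pos
  rw [cr_toC]
  have h2 : 0 < Real.sin (Real.pi * arcLen a b) :=
    Real.sin_pos_of_pos_of_lt_pi (by nlinarith) (by nlinarith)
  have h3 : 0 < Real.sin (Real.pi * arcLen a x) :=
    Real.sin_pos_of_pos_of_lt_pi (by nlinarith) (by nlinarith)
  have h4 : Real.sin (Real.pi * (arcLen a x - arcLen a b)) < 0 :=
    Real.sin_neg_of_neg_of_neg_pi_lt (by nlinarith) (by nlinarith)
  exact mul_neg_of_pos_of_neg (by positivity) h4

lemma cr_pos_of_lt {a b x : S1} (h0 : 0 < arcLen a b) (h1 : arcLen a b < arcLen a x) :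
    0 < cr a b (toC x) := by
  have hb := arcLen_lt_one a x
  have hπ := Real.pi_pos
  rw [cr_toC]
  have h2 : 0 < Real.sin (Real.pi * arcLen a b) :=
    Real.sin_pos_of_pos_of_lt_pi (by nlinarith) (by nlinarith)
  have h3 : 0 < Real.sin (Real.pi * arcLen a x) :=
    Real.sin_pos_of_pos_of_lt_pi (by nlinarith) (by nlinarith)
  have h4 : 0 < Real.sin (Real.pi * (arcLen a x - arcLen a b)) :=
    Real.sin_pos_of_pos_of_lt_pi (by nlinarith) (by nlinarith)
  positivity

lemma cr_left (a b : S1) : cr a b (toC a) = 0 := by simp [cr]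

lemma cr_right (a b : S1) : cr a b (toC b) = 0 := by simp [cr, mul_comm]

lemma eq_or_eq_of_cr_eq_zero {a b x : S1} (hab : a ≠ b) (h : cr a b (toC x) = 0) :
    x = a ∨ x = b := by
  by_contra! hne
  rcases lt_trichotomy (arcLen a x) (arcLen a b) with h1 | h1 | h1
  · exact (cr_neg_of_lt (arcLen_pos.2 hne.1.symm) h1).ne h
  · exact hne.2 (arcLen_left_inj h1)
  · exact (cr_pos_of_lt (arcLen_pos.2 hab) h1).ne' h

lemma toC_injective : Function.Injective toC := by
  intro x y h
  by_contra hne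
  have h1 : x ≠ antip x := (add_coe_ne x (by norm_num) (by norm_num)).symm
  have h2 : cr x (antip x) (toC y) = 0 := by rw [← h, cr_left]
  rcases eq_or_eq_of_cr_eq_zero h1 h2 with rfl | rfl
  · exact hne rfl
  · rw [toC_antip] at h
    have h3 := norm_toC x
    rw [self_eq_neg.1 h, norm_zero] at h3
    exact zero_ne_one h3

lemma toC_sub_ne_zero {a b : S1} (hab : a ≠ b) : toC b - toC a ≠ 0 :=
  sub_ne_zero.2 fun h => hab (toC_injective h).symm

lemma cr_swap (a b : S1) (z : ℂ) : cr b a z = -cr a b z := by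
  simp only [cr, Complex.sub_re, Complex.sub_im]; ring

lemma cr_combo (a b : S1) (z w : ℂ) {s t : ℝ} (h : s + t = 1) :
    cr a b (s • z + t • w) = s * cr a b z + t * cr a b w := by
  obtain rfl : s = 1 - t := by linarith
  simp only [cr, Complex.sub_re, Complex.sub_im, Complex.add_re, Complex.add_im, Complex.smul_re,
    Complex.smul_im, smul_eq_mul]
  ring

lemma cr_add_normal (a b : S1) (z : ℂ) (δ : ℝ) :
    cr a b (z + δ • (Complex.I * (toC b - toC a))) =
      cr a b z + δ * Complex.normSq (toC b - toC a) := by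
  simp only [cr, Complex.normSq_apply, Complex.sub_re, Complex.sub_im, Complex.add_re,
    Complex.add_im, Complex.smul_re, Complex.smul_im, smul_eq_mul, Complex.mul_re, Complex.mul_im,
    Complex.I_re, Complex.I_im]
  ring

lemma continuous_cr (a b : S1) : Continuous (cr a b) := by
  unfold cr; fun_prop

lemma convex_cr_nonneg (a b : S1) : Convex ℝ {z | 0 ≤ cr a b z} := by
  intro z hz w hw s t hs ht hst
  rw [mem_ofPred, cr_combo _ _ _ _ hst]
  exact add_nonneg (mul_nonneg hs hz) (mul_nonneg ht hw)

lemma cr_eq_zero_of_mem_segment {a b : S1} {z : ℂ} (h : z ∈ segment ℝ (toC a) (toC b)) :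
    cr a b z = 0 := by
  obtain ⟨s, t, -, -, hst, rfl⟩ := h
  rw [cr_combo _ _ _ _ hst, cr_left, cr_right]; simp

lemma mem_segment_of_cr_eq_zero {a b : S1} (hab : a ≠ b) {z : ℂ} (hz : ‖z‖ ≤ 1)
    (h : cr a b z = 0) : z ∈ segment ℝ (toC a) (toC b) := by
  have hd : 0 < Complex.normSq (toC b - toC a) := Complex.normSq_pos.2 (toC_sub_ne_zero hab)
  have ha := toC_re_sq_add_im_sq a
  have hb := toC_re_sq_add_im_sq b
  have hz2 : z.re ^ 2 + z.im ^ 2 ≤ 1 := by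
    have := Complex.sq_norm z
    rw [Complex.normSq_apply] at this
    nlinarith [norm_nonneg z]
  simp only [cr, Complex.normSq_apply, Complex.sub_re, Complex.sub_im] at h hd
  generalize hA : toC a = A at *
  generalize hB : toC b = B at *
  obtain ⟨a1, a2⟩ := A
  obtain ⟨b1, b2⟩ := B
  obtain ⟨z1, z2⟩ := z
  dsimp only at *
  set D := (b1 - a1) * (b1 - a1) + (b2 - a2) * (b2 - a2) with hD
  set τ := ((z1 - a1) * (b1 - a1) + (z2 - a2) * (b2 - a2)) / D with hτ
  have h1 : z1 = a1 + τ * (b1 - a1) := by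
    have : (z1 - a1) * D = τ * D * (b1 - a1) := by
      rw [hτ, div_mul_cancel₀ _ hd.ne', hD]; linear_combination (-(b2 - a2)) * h
    have := mul_right_cancel₀ hd.ne' (this.trans (show τ * D * (b1 - a1) = τ * (b1 - a1) * D by ring))
    linarith
  have h2 : z2 = a2 + τ * (b2 - a2) := by
    have : (z2 - a2) * D = τ * D * (b2 - a2) := by
      rw [hτ, div_mul_cancel₀ _ hd.ne', hD]; linear_combination (b1 - a1) * h
    have := mul_right_cancel₀ hd.ne' (this.trans (show τ * D * (b2 - a2) = τ * (b2 - a2) * D by ring))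
    linarith
  have h3 : τ * (τ - 1) * D ≤ 0 := by
    rw [h1, h2] at hz2
    have : τ * (τ - 1) * D = (a1 + τ * (b1 - a1)) ^ 2 + (a2 + τ * (b2 - a2)) ^ 2 - 1 := by
      rw [hD]; linear_combination (τ - 1) * ha - τ * hb
    linarith
  have h4 : τ * (τ - 1) ≤ 0 := by
    by_contra! h5
    exact absurd (mul_pos h5 hd) (not_lt.2 h3)
  refine ⟨1 - τ, τ, by nlinarith, by nlinarith, by ring, ?_⟩
  apply Complex.ext
  · simp only [Complex.add_re, Complex.smul_re, smul_eq_mul]; rw [h1]; ring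
  · simp only [Complex.add_im, Complex.smul_im, smul_eq_mul]; rw [h2]; ring

lemma mem_of_toC_mem_convexHull {F : Set S1} {x : S1} (h : toC x ∈ convexHull ℝ (toC '' F)) :
    x ∈ F := by
  have hsub : convexHull ℝ (toC '' F) ⊆ closedBall (0 : ℂ) 1 := by
    refine convexHull_min ?_ (convex_closedBall _ _)
    rintro _ ⟨y, -, rfl⟩
    simp [norm_toC]
  have hext : toC x ∈ extremePoints ℝ (closedBall (0 : ℂ) 1) :=
    StrictConvexSpace.sphere_subset_extremePoints_closedBall _ one_ne_zero
      (by simp [norm_toC])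
  obtain ⟨y, hy, hyx⟩ := extremePoints_convexHull_subset
    (inter_extremePoints_subset_extremePoints_of_subset hsub ⟨h, hext⟩)
  rwa [← toC_injective hyx]

lemma gapVerts_convexHull (F : Set S1) : gapVerts (convexHull ℝ (toC '' F)) = F :=
  Subset.antisymm (fun _ h => mem_of_toC_mem_convexHull h)
    fun _ h => subset_convexHull ℝ _ (mem_image_of_mem _ h)

lemma gapIter_succ_eq (n : ℕ) (G : Set ℂ) :
    gapIter (n + 1) G = convexHull ℝ (toC '' (s3^[n + 1] '' gapVerts G)) := by
  induction n with
  | zero => rfl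
  | succ n ih =>
    rw [gapIter, Function.iterate_succ_apply', ← gapIter, ih, gapImage, gapVerts_convexHull,
      Function.iterate_succ' s3 (n + 1), image_comp]

lemma gapIter_eq {n : ℕ} (hn : 1 ≤ n) (G : Set ℂ) :
    gapIter n G = convexHull ℝ (toC '' (s3^[n] '' gapVerts G)) := by
  obtain ⟨n, rfl⟩ := Nat.exists_eq_add_of_le' hn
  exact gapIter_succ_eq n G

lemma neg_image_convexHull (F : Set S1) :
    (fun z : ℂ => -z) '' convexHull ℝ (toC '' F) = convexHull ℝ (toC '' (antip '' F)) := by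
  have h := (-LinearMap.id : ℂ →ₗ[ℝ] ℂ).image_convexHull (toC '' F)
  rw [show ((fun z : ℂ => -z) : ℂ → ℂ) = ⇑(-LinearMap.id : ℂ →ₗ[ℝ] ℂ) from rfl, h]
  simp only [image_image]
  congr 2
  ext x
  simp [toC_antip]

lemma isHole_of_cr_nonneg {V : Set S1} {a b : S1} (ha : a ∈ V) (hb : b ∈ V) (hab : a ≠ b)
    (h : ∀ x ∈ V, 0 ≤ cr a b (toC x)) : IsHole V a b :=
  ⟨ha, hb, hab, fun x hx hxa => by
    by_contra! hlt
    exact absurd (h x hx) (not_le.2 (cr_neg_of_lt (arcLen_pos.2 hxa.symm) hlt))⟩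

lemma IsHole.cr_nonneg {V : Set S1} {a b : S1} (h : IsHole V a b) {x : S1} (hx : x ∈ V) :
    0 ≤ cr a b (toC x) := by
  rcases eq_or_ne x a with rfl | hxa
  · rw [cr_left]
  rcases eq_or_ne x b with rfl | hxb
  · rw [cr_right]
  · refine (cr_pos_of_lt (arcLen_pos.2 h.ne) (lt_of_le_of_ne (h.le x hx hxa) fun h => ?_)).le
    exact hxb (arcLen_left_inj h).symm

lemma IsHole.cr_nonneg_of_mem {V : Set S1} {a b : S1} (h : IsHole V a b) {z : ℂ}
    (hz : z ∈ convexHull ℝ (toC '' V)) : 0 ≤ cr a b z := by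
  refine convexHull_min ?_ (convex_cr_nonneg a b) hz
  rintro _ ⟨x, hx, rfl⟩
  exact h.cr_nonneg hx

/-- Moving against the normal direction inside a neighbourhood makes `cr` negative. -/
lemma exists_cr_lt_of_mem_interior {G : Set ℂ} {a b : S1} (hab : a ≠ b) {z : ℂ}
    (hz : z ∈ interior G) : ∃ w ∈ G, cr a b w < cr a b z := by
  have hcont : Continuous fun δ : ℝ => z + δ • (Complex.I * (toC b - toC a)) := by fun_prop
  have hopen : IsOpen ((fun δ : ℝ => z + δ • (Complex.I * (toC b - toC a))) ⁻¹' interior G) :=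
    isOpen_interior.preimage hcont
  obtain ⟨ε, hε, hball⟩ := Metric.isOpen_iff.1 hopen 0 (by simpa using hz)
  have hmem : -(ε / 2) ∈ ball (0 : ℝ) ε := by
    rw [mem_ball_zero_iff, norm_neg, Real.norm_of_nonneg (by linarith)]; linarith
  refine ⟨_, interior_subset (hball hmem), ?_⟩
  rw [cr_add_normal]
  nlinarith [Complex.normSq_pos.2 (toC_sub_ne_zero hab)]

lemma IsHole.isEdgeOf {V : Set S1} (hV : V.Finite) {a b : S1} (h : IsHole V a b) :
    IsEdgeOf (convexHull ℝ (toC '' V)) s(a, b) := by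
  refine ⟨by simpa using h.ne, ?_⟩
  have hclosed : IsClosed (convexHull ℝ (toC '' V)) :=
    ((hV.image toC).isCompact_convexHull ℝ).isClosed
  intro z hz
  change z ∈ segment ℝ (toC a) (toC b) at hz
  rw [hclosed.frontier_eq]
  refine ⟨(convex_convexHull ℝ _).segment_subset
    (subset_convexHull ℝ _ (mem_image_of_mem _ h.left_mem))
    (subset_convexHull ℝ _ (mem_image_of_mem _ h.right_mem)) hz, fun hint => ?_⟩
  obtain ⟨w, hw, hlt⟩ := exists_cr_lt_of_mem_interior h.ne hint
  rw [cr_eq_zero_of_mem_segment hz] at hlt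
  exact absurd (h.cr_nonneg_of_mem hw) (not_le.2 hlt)

/-- A real functional with `toC b - toC a` in its kernel is proportional to `cr a b`. -/
lemma map_mul_normSq_eq (f : ℂ →L[ℝ] ℝ) {a b : S1} (h : f (toC b) = f (toC a)) (z : ℂ) :
    (f z - f (toC a)) * Complex.normSq (toC b - toC a) =
      cr a b z * ((toC b - toC a).re * f Complex.I - (toC b - toC a).im * f 1) := by
  have key : ∀ w, f w = w.re * f 1 + w.im * f Complex.I := fun w => by
    conv_lhs => rw [← Complex.re_add_im w, map_add]
    rw [show (w.re : ℂ) = w.re • (1 : ℂ) by simp,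
      show (w.im : ℂ) * Complex.I = w.im • Complex.I by simp, map_smul, map_smul]
    rfl
  rw [key, key (toC a)] at h
  rw [key z, key (toC a)]
  simp only [cr, Complex.normSq_apply, Complex.sub_re, Complex.sub_im]
  linear_combination (((toC b).re - (toC a).re) * (z.re - (toC a).re) +
    ((toC b).im - (toC a).im) * (z.im - (toC a).im)) * h

lemma isHole_of_isEdgeOf {V : Set S1} (hV : V.Finite)
    (hint : (interior (convexHull ℝ (toC '' V))).Nonempty) {a b : S1}
    (h : IsEdgeOf (convexHull ℝ (toC '' V)) s(a, b)) : IsHole V a b ∨ IsHole V b a := by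
  obtain ⟨hab, hsub⟩ := h
  rw [Sym2.mk_isDiag_iff] at hab
  change segment ℝ (toC a) (toC b) ⊆ _ at hsub
  set G := convexHull ℝ (toC '' V) with hG
  have hconv : Convex ℝ G := convex_convexHull ℝ _
  have hclosed : IsClosed G := ((hV.image toC).isCompact_convexHull ℝ).isClosed
  have hGa : toC a ∈ G := hclosed.frontier_subset (hsub (left_mem_segment ℝ _ _))
  have hGb : toC b ∈ G := hclosed.frontier_subset (hsub (right_mem_segment ℝ _ _))
  have ha := mem_of_toC_mem_convexHull hGa
  have hb := mem_of_toC_mem_convexHull hGb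
  have hm : midpoint ℝ (toC a) (toC b) ∉ interior G := by
    have := hsub (midpoint_mem_segment (𝕜 := ℝ) (toC a) (toC b))
    rw [hclosed.frontier_eq] at this
    exact this.2
  obtain ⟨f, hf⟩ := geometric_hahn_banach_open_point hconv.interior isOpen_interior hm
  have hfm : f (midpoint ℝ (toC a) (toC b)) = (f (toC a) + f (toC b)) / 2 := by
    rw [midpoint_eq_smul_add, map_smul, map_add, smul_eq_mul]
    simp only [invOf_eq_inv]; ring
  rw [hfm] at hf
  have hle : ∀ z ∈ G, f z ≤ (f (toC a) + f (toC b)) / 2 := by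
    have hcl : closure (interior G) = G := by
      rw [hconv.closure_interior_eq_closure_of_nonempty_interior hint, hclosed.closure_eq]
    intro z hz
    rw [← hcl] at hz
    exact closure_minimal (fun w hw => (hf w hw).le)
      (isClosed_le f.continuous continuous_const) hz
  have h1 := hle _ hGa
  have h2 := hle _ hGb
  have hprop := map_mul_normSq_eq f (a := a) (b := b) (by linarith)
  have hpos := Complex.normSq_pos.2 (toC_sub_ne_zero hab)
  generalize (toC b - toC a).re * f Complex.I - (toC b - toC a).im * f 1 = k at hprop
  obtain ⟨w, hw⟩ := hint
  have hk : k ≠ 0 := by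
    rintro rfl
    have h3 := hf w hw
    have h4 := hprop w
    rw [mul_zero] at h4
    rcases mul_eq_zero.1 h4 with h5 | h5 <;> linarith
  have hsign : ∀ x ∈ V, cr a b (toC x) * k ≤ 0 := fun x hx => by
    rw [← hprop]
    have := hle _ (subset_convexHull ℝ _ (mem_image_of_mem toC hx))
    exact mul_nonpos_of_nonpos_of_nonneg (by linarith) hpos.le
  rcases hk.lt_or_gt with hk | hk
  · left
    exact isHole_of_cr_nonneg ha hb hab fun x hx => by
      by_contra! hneg
      exact absurd (hsign x hx) (not_le.2 (mul_pos_of_neg_of_neg hneg hk))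
  · right
    refine isHole_of_cr_nonneg hb ha (Ne.symm hab) fun x hx => ?_
    rw [cr_swap]
    by_contra! hneg
    exact absurd (hsign x hx) (not_le.2 (mul_pos (by linarith) hk))

section Gap

variable {L : Set Chord} {G : Set ℂ}

/-- A leaf does not separate a gap. -/
lemma IsGapOf.cr_nonneg_or_nonpos (hG : IsGapOf L G) {a b : S1}
    (hab : a ≠ b) (h : s(a, b) ∈ L) : (∀ z ∈ G, 0 ≤ cr a b z) ∨ ∀ z ∈ G, cr a b z ≤ 0 := by
  obtain ⟨z₀, hz₀, rfl⟩ := hG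
  set U := connectedComponentIn (openDisk \ unionSet L) z₀
  have hU : IsPreconnected U := isPreconnected_connectedComponentIn
  have hne : ∀ z ∈ U, cr a b z ≠ 0 := by
    intro z hz h0
    have hz' := connectedComponentIn_subset _ _ hz
    have hz1 : ‖z‖ < 1 := mem_ball_zero_iff.1 hz'.1
    exact hz'.2 (mem_biUnion h (mem_segment_of_cr_eq_zero hab hz1.le h0))
  by_cases hpos : ∃ z ∈ U, 0 < cr a b z
  · left
    obtain ⟨z, hz, hz0⟩ := hpos
    refine fun w hw => closure_minimal (fun w hw => ?_)
      (isClosed_le continuous_const (continuous_cr a b)) hw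
    change 0 ≤ cr a b w
    by_contra! hneg
    obtain ⟨v, hv, hv0⟩ := hU.intermediate_value hw hz (continuous_cr a b).continuousOn
      ⟨hneg.le, hz0.le⟩
    exact hne v hv hv0
  · right
    push Not at hpos
    exact fun w hw => closure_minimal hpos (isClosed_le (continuous_cr a b) continuous_const) hw

lemma IsGapOf.interior_nonempty (hL : IsLamination L) (hG : IsGapOf L G) :
    (interior G).Nonempty := by
  obtain ⟨z₀, hz₀, rfl⟩ := hG
  have hopen : IsOpen (openDisk \ unionSet L) := isOpen_ball.sdiff hL.closed
  exact ⟨z₀, interior_maximal subset_closure hopen.connectedComponentIn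
    (mem_connectedComponentIn hz₀)⟩

/-- A boundary point of a gap inside the open disk lies on a leaf. -/
lemma IsGapOf.mem_unionSet (hL : IsLamination L) (hG : IsGapOf L G) {z : ℂ} (hz : z ∈ G)
    (hint : z ∉ interior G) (hdisk : z ∈ openDisk) : z ∈ unionSet L := by
  obtain ⟨z₀, hz₀, rfl⟩ := hG
  have hopen : IsOpen (openDisk \ unionSet L) := isOpen_ball.sdiff hL.closed
  by_contra hzL
  have hzC := mem_connectedComponentIn (F := openDisk \ unionSet L) ⟨hdisk, hzL⟩
  obtain ⟨w, hw, hw'⟩ := mem_closure_iff.1 hz _ hopen.connectedComponentIn hzC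
  have h1 := connectedComponentIn_eq hw
  have h2 := connectedComponentIn_eq hw'
  rw [h1, ← h2] at hzC
  exact hint (interior_maximal subset_closure hopen.connectedComponentIn hzC)

variable {V : Set S1}

lemma exists_third_of_interior_nonempty (hint : (interior (convexHull ℝ (toC '' V))).Nonempty)
    (x y : S1) : ∃ z ∈ V, z ≠ x ∧ z ≠ y := by
  have key : ∀ y, x ≠ y → ∃ z ∈ V, z ≠ x ∧ z ≠ y := by
    intro y hxy
    by_contra! hno
    have hzero : ∀ z ∈ convexHull ℝ (toC '' V), cr x y z = 0 := by
      intro z hz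
      refine cr_eq_zero_of_mem_segment (convexHull_min ?_ (convex_segment _ _) hz)
      rintro _ ⟨v, hv, rfl⟩
      rcases eq_or_ne v x with rfl | hvx
      · exact left_mem_segment ℝ _ _
      · rw [hno v hv hvx]; exact right_mem_segment ℝ _ _
    obtain ⟨z, hz⟩ := hint
    obtain ⟨w, hw, hlt⟩ := exists_cr_lt_of_mem_interior hxy hz
    rw [hzero w hw, hzero z (interior_subset hz)] at hlt
    exact hlt.false
  rcases eq_or_ne x y with rfl | hxy
  · obtain ⟨z, hz, hzx, -⟩ := key (antip x) (add_coe_ne x (by norm_num) (by norm_num)).symm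
    exact ⟨z, hz, hzx, hzx⟩
  · exact key y hxy

lemma IsGapOf.hole_mem (hL : IsLamination L) (hG : IsGapOf L (convexHull ℝ (toC '' V)))
    (hV : V.Finite) {u v : S1} (h : IsHole V u v) : s(u, v) ∈ L := by
  have hGu := subset_convexHull ℝ _ (mem_image_of_mem toC h.left_mem)
  have hGv := subset_convexHull ℝ _ (mem_image_of_mem toC h.right_mem)
  have hmseg := midpoint_mem_segment (𝕜 := ℝ) (toC u) (toC v)
  have hmf := (h.isEdgeOf hV).2 hmseg
  have hm : midpoint ℝ (toC u) (toC v) = (1/2 : ℝ) • toC u + (1/2 : ℝ) • toC v := by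
    rw [midpoint_eq_smul_add, smul_add, invOf_eq_inv, one_div]
  have hdisk : midpoint ℝ (toC u) (toC v) ∈ openDisk := by
    rw [hm, openDisk, mem_ball_zero_iff]
    exact norm_combo_lt_of_ne (norm_toC u).le (norm_toC v).le (fun h' => h.ne (toC_injective h'))
      (by norm_num) (by norm_num) (by norm_num)
  obtain ⟨ℓ, hℓ, hmℓ⟩ := mem_iUnion₂.1 (hG.mem_unionSet hL
    ((convex_convexHull ℝ _).segment_subset hGu hGv hmseg) hmf.2 hdisk)
  induction ℓ using Sym2.ind with
  | _ c d =>
    change _ ∈ segment ℝ (toC c) (toC d) at hmℓ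
    rcases eq_or_ne c d with rfl | hcd
    · rw [segment_same, mem_singleton_iff] at hmℓ
      rw [hmℓ, openDisk, mem_ball_zero_iff, norm_toC] at hdisk
      exact (lt_irrefl _ hdisk).elim
    have h0 := cr_eq_zero_of_mem_segment hmℓ
    rw [hm, cr_combo _ _ _ _ (by norm_num)] at h0
    have hzero : cr c d (toC u) = 0 ∧ cr c d (toC v) = 0 := by
      rcases hG.cr_nonneg_or_nonpos hcd hℓ with hs | hs
      · have h1 := hs _ hGu
        have h2 := hs _ hGv
        constructor <;> linarith
      · have h1 := hs _ hGu
        have h2 := hs _ hGv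
        constructor <;> linarith
    rcases eq_or_eq_of_cr_eq_zero hcd hzero.1 with rfl | rfl <;>
      rcases eq_or_eq_of_cr_eq_zero hcd hzero.2 with rfl | rfl
    · exact (h.ne rfl).elim
    · exact hℓ
    · rwa [Sym2.eq_swap]
    · exact (h.ne rfl).elim

lemma IsGapOf.isPolygon (hL : IsLamination L) (hG : IsGapOf L (convexHull ℝ (toC '' V)))
    (hV : V.Finite) {N : ℕ} (hN : ∀ x ∈ V, s3^[N] x = x) : IsPolygon L N V where
  finite := hV
  third := exists_third_of_interior_nonempty (hG.interior_nonempty hL)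
  hole_mem _ _ h := hG.hole_mem hL hV h
  diag u hu v hv huv h := by
    have hmem : ∀ x ∈ V, toC x ∈ convexHull ℝ (toC '' V) := fun x hx =>
      subset_convexHull ℝ _ (mem_image_of_mem toC hx)
    rcases hG.cr_nonneg_or_nonpos huv h with hs | hs
    · exact Or.inl (isHole_of_cr_nonneg hu hv huv fun x hx => hs _ (hmem x hx))
    · refine Or.inr (isHole_of_cr_nonneg hv hu huv.symm fun x hx => ?_)
      rw [cr_swap]
      linarith [hs _ (hmem x hx)]
  periodic := hN

end Gap

lemma exists_period {V : Set S1} (hV : V.Finite) {p : ℕ} (hp : 1 ≤ p) (h : s3^[p] '' V = V) :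
    ∃ N, 1 ≤ N ∧ ∀ x ∈ V, s3^[N] x = x := by
  have hmaps : MapsTo s3^[p] V V := mapsTo_iff_image_subset.2 h.subset
  have hsurj : SurjOn s3^[p] V V := h.superset
  have : Finite V := hV
  have hbij : Function.Bijective (hmaps.restrict s3^[p] V V) :=
    Finite.surjective_iff_bijective.1 (hmaps.restrict_surjective_iff.2 hsurj)
  let e : Equiv.Perm V := Equiv.ofBijective _ hbij
  have he : ∀ n (x : V), ((e ^ n) x : S1) = s3^[p * n] x := by
    intro n
    induction n with
    | zero => exact fun _ => rfl
    | succ n ih =>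
      intro x
      rw [pow_succ, Equiv.Perm.mul_apply, ih, Nat.mul_succ, Function.iterate_add_apply]
      rfl
  refine ⟨p * orderOf e, Nat.mul_pos hp (orderOf_pos e), fun x hx => ?_⟩
  rw [← he _ ⟨x, hx⟩, pow_orderOf_eq_one]
  rfl

section

variable {L : Set Chord} {N : ℕ} {V : Set S1}

lemma IsPolygon.image_eq_of_hole (hL : IsCubicSymLam L) (hN : 1 ≤ N) (hV : IsPolygon L N V)
    {φ : S1 → S1} (hφ : IsDyn φ) {u v : S1} (h : IsHole V u v) (h' : IsHole V (φ u) (φ v)) :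
    φ '' V = V :=
  (hV.image hL hN hφ).eq_of_hole hL.unlinked hV (hV.map_hole hL hN hφ h) h'

/-- Dynamical maps preserving a periodic polygon preserve the circular order of its vertices. -/
lemma IsPolygon.sbtw3_map (hL : IsCubicSymLam L) (hN : 1 ≤ N) (hV : IsPolygon L N V)
    {φ : S1 → S1} (hφ : IsDyn φ) (himg : φ '' V = V) {x y z : S1} (hx : x ∈ V) (hy : y ∈ V)
    (hz : z ∈ V) (h : Sbtw3 x y z) : Sbtw3 (φ x) (φ y) (φ z) := by
  have hinj : ∀ a ∈ V, ∀ b ∈ V, a ≠ b → φ a ≠ φ b := fun a ha b hb hab h =>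
    hab (hφ.injOn_periodic hN (hV.periodic a ha) (hV.periodic b hb) h)
  have hmem : ∀ a ∈ V, φ a ∈ V := fun a ha => himg ▸ mem_image_of_mem φ ha
  have hbase : ∀ z ∈ V, arcLen x x < arcLen x z → arcLen (φ x) (φ x) < arcLen (φ x) (φ z) := by
    intro z hz hlt
    rw [arcLen_self] at hlt ⊢
    exact arcLen_pos.2 (hinj x hx z hz (arcLen_pos.1 hlt))
  have key := forall_mem_of_hole_step hV.finite
    (fun y => ∀ z ∈ V, arcLen x y < arcLen x z → arcLen (φ x) (φ y) < arcLen (φ x) (φ z))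
    hx hbase (fun u v huv hu z hz hlt => by
      rcases eq_or_ne v x with rfl | hvx
      · exact hbase z hz hlt
      have huv' := hV.map_hole hL hN hφ huv
      rw [himg] at huv'
      have h1 : arcLen x u < arcLen x v := by
        have h2 := arcLen_pos.2 hvx.symm
        rcases eq_or_ne x u with rfl | hxu
        · rwa [arcLen_self]
        · have h3 := huv.le x hx hxu
          have h4 := arcLen_of_base x u v
          have h5 := arcLen_of_base x u x
          have h6 := arcLen_self x
          have h7 := arcLen_nonneg x u
          refine lt_of_le_of_ne ?_ fun h => huv.ne (arcLen_left_inj h)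
          rcases h4 with h4 | h4 <;> rcases h5 with h5 | h5 <;> linarith
      have h2 := hu v huv.right_mem h1
      have h3 := hu z hz (h1.trans hlt)
      have hzu : z ≠ u := by rintro rfl; exact (h1.trans hlt).false
      have hzv : z ≠ v := by rintro rfl; exact hlt.false
      have h4 := huv'.le _ (hmem z hz) (hinj z hz u huv.left_mem hzu)
      refine lt_of_le_of_ne ?_ fun h => hinj z hz v huv.right_mem hzv (arcLen_left_inj h).symm
      have h5 := arcLen_of_base (φ x) (φ u) (φ v)
      have h6 := arcLen_of_base (φ x) (φ u) (φ z)
      rcases h5 with h5 | h5 <;> rcases h6 with h6 | h6 <;> linarith)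
  rw [sbtw3_iff] at h ⊢
  exact ⟨arcLen_pos.2 (hinj x hx y hy (arcLen_pos.1 h.1)), key y hy z hz h.2⟩

lemma IsPolygon.right_eq (hL : IsCubicSymLam L) (hN : 1 ≤ N) (hV : IsPolygon L N V)
    {φ : S1 → S1} (hφ : IsDyn φ) (himg : φ '' V = V) {u v u' v' : S1} (h : IsHole V u v)
    (h' : IsHole V u' v') (hu : φ u = u') : φ v = v' := by
  have h1 := hV.map_hole hL hN hφ h
  rw [himg, hu] at h1
  exact h1.right_unique h'

/-- If an iterate of `s3` shifts one hole to the next one, then iterates of `s3` act transitively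
on holes. -/
lemma IsPolygon.exists_iterate_of_shift (hL : IsCubicSymLam L) (hN : 1 ≤ N)
    (hV : IsPolygon L N V) {k : ℕ} {u v w : S1} (huv : IsHole V u v) (hvw : IsHole V v w)
    (hu : s3^[k] u = v) (hv : s3^[k] v = w) {x y x' y' : S1} (h : IsHole V x y)
    (h' : IsHole V x' y') : ∃ n, s3^[n] x = x' ∧ s3^[n] y = y' := by
  have himg : s3^[k] '' V = V :=
    hV.image_eq_of_hole hL hN (isDyn_iterate k) huv (by rwa [hu, hv])
  have hnext := forall_mem_of_hole_step hV.finite (fun a => IsHole V a (s3^[k] a)) huv.left_mem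
    (by rwa [hu]) (fun a b hab ha => by
      have h1 := hV.map_hole hL hN (isDyn_iterate k) hab
      rwa [himg, ha.right_unique hab] at h1)
  obtain ⟨n, hn, hnx⟩ := forall_mem_of_hole_step hV.finite
    (fun a => ∃ n, s3^[n] '' V = V ∧ s3^[n] x = a) h.left_mem ⟨0, by simp, rfl⟩
    (fun a b hab ⟨n, hn, hna⟩ => by
      refine ⟨k + n, ?_, ?_⟩
      · rw [Function.iterate_add, image_comp, hn, himg]
      · rw [Function.iterate_add_apply, hna]
        exact (hnext a hab.left_mem).right_unique hab) x' h'.left_mem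
  exact ⟨n, hnx, hV.right_eq hL hN (isDyn_iterate n) hn h h' hnx⟩

lemma IsPolygon.exists_antip_iterate_of_adjacent (hL : IsCubicSymLam L) (hN : 1 ≤ N)
    (hV : IsPolygon L N V) {x y x' y' : S1} (h : IsHole V x y) (h' : IsHole V x' y')
    (hno : ∀ n, ¬(s3^[n] x = x' ∧ s3^[n] y = y')) {u v u' v' : S1} (hl : IsHole V u v)
    (hl' : IsHole V u' v') (hadj : v = u' ∨ u = v') :
    ∃ k, antip (s3^[k] u) = u' ∧ antip (s3^[k] v) = v' := by
  obtain ⟨φ, ⟨k, rfl | rfl⟩, hu, hv⟩ := hV.exists_dyn_of_holes hL hN hl hl'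
  · exfalso
    rcases hadj with rfl | rfl
    · obtain ⟨n, hn⟩ := hV.exists_iterate_of_shift hL hN hl hl' hu hv h h'
      exact hno n hn
    · have h1 := iterate_cancel hN k (hV.periodic u hl.left_mem)
      have h2 := iterate_cancel hN k (hV.periodic v hl.right_mem)
      rw [hu] at h1
      rw [hv] at h2
      obtain ⟨n, hn⟩ := hV.exists_iterate_of_shift hL hN hl' hl h1 h2 h h'
      exact hno n hn
  · exact ⟨k, hu, hv⟩

/-- If iterates of `s3` do not map the first hole to the second, every hole is an iterated image
of one of them. -/
lemma IsPolygon.exists_iterate_or (hL : IsCubicSymLam L) (hN : 1 ≤ N)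
    (hV : IsPolygon L N V) {x y x' y' : S1} (h : IsHole V x y) (h' : IsHole V x' y')
    (hno : ∀ n, ¬(s3^[n] x = x' ∧ s3^[n] y = y')) {u v : S1} (hl : IsHole V u v) :
    (∃ n, s3^[n] x = u ∧ s3^[n] y = v) ∨ ∃ n, s3^[n] x' = u ∧ s3^[n] y' = v := by
  obtain ⟨φ, ⟨k, rfl | rfl⟩, hx, hy⟩ := hV.exists_dyn_of_holes hL hN h hl
  · exact Or.inl ⟨k, hx, hy⟩
  obtain ⟨φ, ⟨m, rfl | rfl⟩, hx', hy'⟩ := hV.exists_dyn_of_holes hL hN h' hl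
  · exact Or.inr ⟨m, hx', hy'⟩
  refine (hno (N * m - m + k) ⟨?_, ?_⟩).elim
  · rw [Function.iterate_add_apply, antip_injective (hx.trans hx'.symm),
      iterate_cancel hN m (hV.periodic x' h'.left_mem)]
  · rw [Function.iterate_add_apply, antip_injective (hy.trans hy'.symm),
      iterate_cancel hN m (hV.periodic y' h'.right_mem)]

lemma dvd_of_image_eq {p : ℕ} (hp : 1 ≤ p) (h : s3^[p] '' V = V)
    (hmin : ∀ q, 1 ≤ q → s3^[q] '' V = V → p ≤ q) {k : ℕ} (hk : s3^[k] '' V = V) : p ∣ k := by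
  have hmul : ∀ n, s3^[p * n] '' V = V := by
    intro n
    induction n with
    | zero => simp
    | succ n ih => rw [Nat.mul_succ, Function.iterate_add, image_comp, h, ih]
  rw [← Nat.mod_add_div k p, Function.iterate_add, image_comp, hmul] at hk
  rw [Nat.dvd_iff_mod_eq_zero]
  by_contra hne
  exact absurd (hmin _ (Nat.one_le_iff_ne_zero.2 hne) hk) (not_le.2 (Nat.mod_lt k hp))

end

theorem periodic_polygon_dichotomy :
    ∀ (L : Set Chord) (G : Set ℂ) (p : ℕ), IsCubicSymLam L → IsGapOf L G →
      (gapVerts G).Finite → 1 ≤ p → gapIter p G = G →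
      (∀ q : ℕ, 1 ≤ q → gapIter q G = G → p ≤ q) →
      Xor'
        -- (a) the first return map acts on the edges transitively as a rational rotation
        ((∀ l : Chord, IsEdgeOf G l → IsEdgeOf G (cmap (s3^[p]) l)) ∧
         (∀ l l' : Chord, IsEdgeOf G l → IsEdgeOf G l' → ∃ n : ℕ, cmap (s3^[n * p]) l = l') ∧
         (∀ x y z : S1, x ∈ gapVerts G → y ∈ gapVerts G → z ∈ gapVerts G → Sbtw3 x y z →
            Sbtw3 (s3^[p] x) (s3^[p] y) (s3^[p] z)))
        -- (b) the edges form exactly two disjoint periodic orbits, G maps onto -G,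
        -- and adjacent edges eventually map to antipodal adjacent edges
        ((∀ l : Chord, IsEdgeOf G l → ChordPeriodic l) ∧
         (∃ e₁ e₂ : Chord, IsEdgeOf G e₁ ∧ IsEdgeOf G e₂ ∧
            (∀ n : ℕ, cmap (s3^[n]) e₁ ≠ e₂) ∧
            (∀ l : Chord, IsEdgeOf G l →
              (∃ n : ℕ, cmap (s3^[n]) e₁ = l) ∨ (∃ n : ℕ, cmap (s3^[n]) e₂ = l))) ∧
         (∃ m : ℕ, gapIter m G = (fun z : ℂ => -z) '' G) ∧
         (∀ l l' : Chord, IsEdgeOf G l → IsEdgeOf G l' → l ≠ l' →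
            (∃ v : S1, v ∈ l ∧ v ∈ l') →
            ∃ n : ℕ, 1 ≤ n ∧ cmap (s3^[n]) l = cmap antip l')) := by
  intro L G p hL hG hfin hp hGp hpmin
  obtain ⟨V, hV⟩ : ∃ V, gapVerts G = V := ⟨_, rfl⟩
  have hVp : s3^[p] '' V = V := by
    have h := congrArg gapVerts hGp
    rwa [gapIter_eq hp, gapVerts_convexHull, hV] at h
  have hGV : G = convexHull ℝ (toC '' V) := by
    rw [← hGp, gapIter_eq hp, hV, hVp]
  have hVmin : ∀ q, 1 ≤ q → s3^[q] '' V = V → p ≤ q := fun q hq h => by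
    refine hpmin q hq ?_
    rw [gapIter_eq hq, hV, h, hGV]
  rw [hV] at hfin ⊢
  clear hGp hpmin
  obtain ⟨N, hN, hper⟩ := exists_period hfin hp hVp
  have hneg : ∀ m, 1 ≤ m → s3^[m] '' V = antip '' V → gapIter m G = (fun z : ℂ => -z) '' G := by
    intro m hm h
    rw [gapIter_eq hm, hV, h, hGV, neg_image_convexHull]
  have hedge : ∀ l, IsEdgeOf G l ↔ ∃ u v, IsHole V u v ∧ l = s(u, v) := by
    intro l
    constructor
    · intro hl
      have hint := hG.interior_nonempty hL.toIsLamination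
      rw [hGV] at hl hint
      induction l using Sym2.ind with
      | _ a b =>
        rcases isHole_of_isEdgeOf hfin hint hl with h | h
        · exact ⟨a, b, h, rfl⟩
        · exact ⟨b, a, h, Sym2.eq_swap⟩
    · rintro ⟨u, v, h, rfl⟩
      rw [hGV]
      exact h.isEdgeOf hfin
  have hpoly : IsPolygon L N V := by
    rw [hGV] at hG
    exact hG.isPolygon hL.toIsLamination hfin hper
  simp only [hedge]
  refine (xor_iff_or_and_not_and _ _).2 ?_
  refine ⟨?_, fun ⟨⟨_, htrans, _⟩, ⟨_, ⟨e₁, e₂, h₁, h₂, hne, _⟩, _⟩⟩ =>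
    (htrans e₁ e₂ h₁ h₂).elim fun n hn => hne _ hn⟩
  by_cases hcyc : ∀ x y x' y', IsHole V x y → IsHole V x' y' →
      ∃ n, s3^[n] x = x' ∧ s3^[n] y = y'
  · left
    refine ⟨?_, ?_, ?_⟩
    · rintro _ ⟨u, v, h, rfl⟩
      have h' := hpoly.map_hole hL hN (isDyn_iterate p) h
      rw [hVp] at h'
      exact ⟨_, _, h', rfl⟩
    · rintro _ _ ⟨u, v, h, rfl⟩ ⟨u', v', h', rfl⟩
      obtain ⟨k, rfl, rfl⟩ := hcyc _ _ _ _ h h'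
      obtain ⟨n, rfl⟩ := dvd_of_image_eq hp hVp hVmin
        (hpoly.image_eq_of_hole hL hN (isDyn_iterate k) h h')
      exact ⟨n, by rw [mul_comm]; rfl⟩
    · intro x y z hx hy hz h
      exact hpoly.sbtw3_map hL hN (isDyn_iterate p) hVp hx hy hz h
  · right
    push Not at hcyc
    obtain ⟨x, y, x', y', h, h', hno⟩ := hcyc
    have hno' : ∀ n, ¬(s3^[n] x = x' ∧ s3^[n] y = y') := fun n hn => hno n hn.1 hn.2
    refine ⟨?_, ⟨s(x, y), s(x', y'), ⟨x, y, h, rfl⟩, ⟨x', y', h', rfl⟩, ?_, ?_⟩, ?_, ?_⟩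
    · rintro _ ⟨u, v, hl, rfl⟩
      exact ⟨N, hN, congrArg₂ (fun a b => s(a, b)) (hper u hl.left_mem) (hper v hl.right_mem)⟩
    · intro n hn
      rcases Sym2.eq_iff.1 hn with hn | ⟨h1, h2⟩
      · exact hno' n hn
      · exact hpoly.not_reversed hL hN h h' (isDyn_iterate n) h1 h2
    · rintro _ ⟨u, v, hl, rfl⟩
      refine (hpoly.exists_iterate_or hL hN h h' hno' hl).imp ?_ ?_ <;>
        rintro ⟨n, rfl, rfl⟩ <;> exact ⟨n, rfl⟩
    · obtain ⟨φ, hφ, rfl, rfl⟩ := hpoly.exists_dyn_of_holes hL hN h h'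
      have himg := hpoly.image_eq_of_hole hL hN hφ h h'
      obtain ⟨k, rfl | rfl⟩ := hφ
      · exact (hno' k ⟨rfl, rfl⟩).elim
      · refine ⟨k + N, hneg _ (by omega) ?_⟩
        conv_rhs => rw [← himg, ← image_comp, ← Function.comp_assoc, antip_comp_antip]
        refine image_congr fun a ha => ?_
        rw [Function.iterate_add_apply, hper a ha]
        rfl
    · rintro _ _ ⟨u, v, hl, rfl⟩ ⟨u', v', hl', rfl⟩ hne ⟨w, hw, hw'⟩
      have hadj : v = u' ∨ u = v' := by
        rcases Sym2.mem_iff.1 hw with rfl | rfl <;> rcases Sym2.mem_iff.1 hw' with rfl | rfl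
        · exact (hne (by rw [hl.right_unique hl'])).elim
        · exact Or.inr rfl
        · exact Or.inl rfl
        · exact (hne (by rw [hl.left_unique hl'])).elim
      obtain ⟨k, rfl, rfl⟩ := hpoly.exists_antip_iterate_of_adjacent hL hN h h' hno' hl hl' hadj
      refine ⟨k + N, by omega, ?_⟩
      simp only [cmap, Sym2.map_mk, antip_antip, Function.iterate_add_apply,
        hper u hl.left_mem, hper v hl.right_mem]

end
end

section
/- Let L be a cubic symmetric lamination with minors {m, −m}, and let ℓ ∈ L be a leaf. Then no forward image of ℓ is shorter than min(‖ℓ‖, ‖m‖): for every n ≥ 0, ‖s3^n(ℓ)‖ ≥ min(‖ℓ‖, ‖m‖). -/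
noncomputable section

open Set Metric

/-- Every point of the circle is, up to sign, represented by its norm. -/
lemma S1.eq_coe_norm_or_neg (x : S1) :
    x = ((‖x‖ : ℝ) : S1) ∨ x = -((‖x‖ : ℝ) : S1) := by
  obtain ⟨t, rfl⟩ := QuotientAddGroup.mk_surjective x
  change ((t : ℝ) : S1) = ((‖((t : ℝ) : S1)‖ : ℝ) : S1) ∨
    ((t : ℝ) : S1) = -((‖((t : ℝ) : S1)‖ : ℝ) : S1)
  have hrep : ((t : ℝ) : S1) = ((t - round t : ℝ) : S1) := by
    rw [AddCircle.coe_sub, eq_comm, sub_eq_self, AddCircle.coe_eq_zero_iff]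
    exact ⟨round t, by simp⟩
  have hnorm : ‖((t : ℝ) : S1)‖ = |t - round t| := by
    rw [AddCircle.norm_eq]; simp
  rw [hnorm]
  rcases abs_choice (t - round t) with h | h
  · left; rw [h]; exact hrep
  · right; rw [h, AddCircle.coe_neg, neg_neg]; exact hrep

lemma S1.norm_le_half (x : S1) : ‖x‖ ≤ 1 / 2 := by
  simpa using AddCircle.norm_le_half_period (1 : ℝ) (x := x) one_ne_zero

lemma S1.norm_three_nsmul_eq_norm_coe (x : S1) :
    ‖(3 : ℕ) • x‖ = ‖((3 * ‖x‖ : ℝ) : S1)‖ := by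
  have h : ((3 * ‖x‖ : ℝ) : S1) = (3 : ℕ) • ((‖x‖ : ℝ) : S1) := by
    rw [← AddCircle.coe_nsmul, nsmul_eq_mul]; norm_num
  rw [h]
  rcases S1.eq_coe_norm_or_neg x with hx | hx
  · rw [← hx]
  · have hx' : ((‖x‖ : ℝ) : S1) = -x := (neg_eq_iff_eq_neg.mpr hx).symm
    rw [hx', smul_neg, norm_neg]

lemma S1.norm_three_nsmul_of_le {x : S1} (hx : ‖x‖ ≤ 1 / 6) : ‖(3 : ℕ) • x‖ = 3 * ‖x‖ := by
  have h0 := norm_nonneg x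
  have habs : |3 * ‖x‖| = 3 * ‖x‖ := abs_of_nonneg (by positivity)
  rw [S1.norm_three_nsmul_eq_norm_coe, (AddCircle.norm_coe_eq_abs_iff 1 one_ne_zero).2, habs]
  rw [habs, abs_one]; linarith

lemma S1.norm_three_nsmul_of_ge {x : S1} (hx : 1 / 6 ≤ ‖x‖) :
    ‖(3 : ℕ) • x‖ = 3 * |1 / 3 - ‖x‖| := by
  have h2 := S1.norm_le_half x
  have hshift : ((3 * ‖x‖ : ℝ) : S1) = ((3 * ‖x‖ - 1 : ℝ) : S1) := by
    rw [AddCircle.coe_sub, AddCircle.coe_period, sub_zero]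
  rw [S1.norm_three_nsmul_eq_norm_coe, hshift, (AddCircle.norm_coe_eq_abs_iff 1 one_ne_zero).2]
  · rw [abs_sub_comm, ← abs_of_pos (show (0 : ℝ) < 3 by norm_num), ← abs_mul,
      abs_of_pos (show (0 : ℝ) < 3 by norm_num)]
    ring_nf
  · rw [abs_one, abs_le]; constructor <;> linarith

lemma chordLen_nonneg (c : Chord) : 0 ≤ chordLen c := by
  induction c using Sym2.ind with | _ a b => exact norm_nonneg (a - b)

lemma chordLen_le_half (c : Chord) : chordLen c ≤ 1 / 2 := by
  induction c using Sym2.ind with | _ a b => exact S1.norm_le_half (a - b)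

lemma chordLen_eq_zero_of_isDiag {c : Chord} (hc : c.IsDiag) : chordLen c = 0 := by
  induction c using Sym2.ind with | _ a b =>
    obtain rfl : a = b := hc
    simp [chordLen]

lemma chordLen_cmap_s3_of_le {c : Chord} (hc : chordLen c ≤ 1 / 6) :
    chordLen (cmap s3 c) = 3 * chordLen c := by
  induction c using Sym2.ind with | _ a b =>
    change ‖(3 : ℕ) • a - (3 : ℕ) • b‖ = 3 * ‖a - b‖
    rw [← smul_sub]
    exact S1.norm_three_nsmul_of_le hc

lemma chordLen_cmap_s3_of_ge {c : Chord} (hc : 1 / 6 ≤ chordLen c) :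
    chordLen (cmap s3 c) = 3 * |1 / 3 - chordLen c| := by
  induction c using Sym2.ind with | _ a b =>
    change ‖(3 : ℕ) • a - (3 : ℕ) • b‖ = 3 * |1 / 3 - ‖a - b‖|
    rw [← smul_sub]
    exact S1.norm_three_nsmul_of_ge hc

/-- The image of a leaf of length at least `1/6` is no shorter than a minor. -/
lemma IsMajor.chordLen_cmap_s3_le {L : Set Chord} {M c : Chord} (hM : IsMajor L M) (hc : c ∈ L)
    (h : 1 / 6 ≤ chordLen c) : chordLen (cmap s3 M) ≤ chordLen (cmap s3 c) := by
  have hle := hM.2 c hc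
  have hc6 : |1 / 3 - chordLen c| ≤ 1 / 6 := by
    rw [abs_le]; constructor <;> linarith [chordLen_le_half c]
  have hM6 : 1 / 6 ≤ chordLen M := by
    linarith [le_abs_self (1 / 3 - chordLen M)]
  rw [chordLen_cmap_s3_of_ge h, chordLen_cmap_s3_of_ge hM6]
  linarith

lemma IsMinor.min_chordLen_le_chordLen_cmap_s3 {L : Set Chord} {m c : Chord} (hm : IsMinor L m)
    (hc : c ∈ L) : min (chordLen c) (chordLen m) ≤ chordLen (cmap s3 c) := by
  obtain ⟨M, hM, rfl⟩ := hm
  rcases le_total (chordLen c) (1 / 6) with h | h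
  · refine (min_le_left _ _).trans ?_
    rw [chordLen_cmap_s3_of_le h]
    linarith [chordLen_nonneg c]
  · exact (min_le_right _ _).trans (hM.chordLen_cmap_s3_le hc h)

lemma cmap_iterate_succ (f : S1 → S1) (n : ℕ) (c : Chord) :
    cmap (f^[n + 1]) c = cmap (f^[n]) (cmap f c) := by
  simp [cmap, Function.iterate_succ, Sym2.map_map]

theorem no_image_shorter_than_min :
    ∀ (L : Set Chord) (m l : Chord), IsCubicSymLam L → IsMinor L m → l ∈ L →
      ∀ n : ℕ, min (chordLen l) (chordLen m) ≤ chordLen (cmap (s3^[n]) l) := by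
  intro L m l hL hm hl n
  induction n generalizing l with
  | zero => simp [cmap]
  | succ n ih =>
    have hstep := hm.min_chordLen_le_chordLen_cmap_s3 hl
    rw [cmap_iterate_succ]
    rcases hL.forward l hl with hmem | hdiag
    · exact (le_min hstep (min_le_right _ _)).trans (ih _ hmem)
    · rw [chordLen_eq_zero_of_isDiag hdiag] at hstep
      exact hstep.trans (chordLen_nonneg _)

end
end
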